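/- Let n ≥ 1, regard ℂⁿ as a 2n-dimensional real vector space, and let 0 ≤ k ≤ 2n with k ≠ n. Every continuous, translation invariant, even, complex-valued valuation μ on ℂⁿ that is homogeneous of degree k and invariant under the special unitary group SU(n) is in fact invariant under the full unitary group U(n), i.e. μ(gK) = μ(K) for all g ∈ U(n) and all nonempty compact convex K ⊆ ℂⁿ. -/

import Mathlib

open MeasureTheory Metric Set
open scoped Pointwise ENNReal

noncomputable section

/-- Complex `n`-space `ℂⁿ`, regarded as a real `2n`-dimensional vector space whose Euclidean
structure is the real part of the standard hermitian inner product. -/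
abbrev Cn (n : ℕ) := EuclideanSpace ℂ (Fin n)

/-- The linear action of a complex matrix on `ℂⁿ`. -/
def uAct {n : ℕ} (g : Matrix (Fin n) (Fin n) ℂ) : Cn n →ₗ[ℂ] Cn n :=
  Matrix.toEuclideanLin g

variable {V : Type*} [NormedAddCommGroup V] [NormedSpace ℝ V]

/-- `μ` is a (complex-valued) valuation: additivity on unions of convex bodies whose
union is again convex. -/
def IsValuationC (μ : ConvexBody V → ℂ) : Prop :=
  ∀ K L M N : ConvexBody V,
    (M : Set V) = (K : Set V) ∪ (L : Set V) → (N : Set V) = (K : Set V) ∩ (L : Set V) →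
      μ M + μ N = μ K + μ L

/-- `μ` is translation invariant. -/
def IsTranslationInvariantC (μ : ConvexBody V → ℂ) : Prop :=
  ∀ (x : V) (K L : ConvexBody V), (L : Set V) = x +ᵥ (K : Set V) → μ L = μ K

/-- `μ` is homogeneous of degree `k`. -/
def IsHomogeneousValC (k : ℕ) (μ : ConvexBody V → ℂ) : Prop :=
  ∀ (t : ℝ), 0 ≤ t → ∀ K L : ConvexBody V,
    (L : Set V) = t • (K : Set V) → μ L = (t : ℂ) ^ k * μ K

/-- `μ` is an even valuation. -/
def IsEvenValC (μ : ConvexBody V → ℂ) : Prop :=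
  ∀ K L : ConvexBody V, (L : Set V) = -(K : Set V) → μ L = μ K

/-- `μ` is invariant under the unitary group `U(n)`. -/
def IsUnitaryInvariant {n : ℕ} (μ : ConvexBody (Cn n) → ℂ) : Prop :=
  ∀ g ∈ Matrix.unitaryGroup (Fin n) ℂ, ∀ K L : ConvexBody (Cn n),
    (L : Set (Cn n)) = (uAct g) '' (K : Set (Cn n)) → μ L = μ K

/-- `μ` is invariant under the special unitary group `SU(n)`. -/
def IsSpecialUnitaryInvariant {n : ℕ} (μ : ConvexBody (Cn n) → ℂ) : Prop :=
  ∀ g ∈ Matrix.specialUnitaryGroup (Fin n) ℂ, ∀ K L : ConvexBody (Cn n),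
    (L : Set (Cn n)) = (uAct g) '' (K : Set (Cn n)) → μ L = μ K

/-! ### Basic set-function framework -/

namespace KlainVal

set_option linter.unusedSectionVars false

variable {X : Type*} [NormedAddCommGroup X] [InnerProductSpace ℝ X]

/-- compact convex sets (possibly empty) -/
def CC (K : Set X) : Prop := Convex ℝ K ∧ IsCompact K

/-- two sets are within Hausdorff distance `δ` -/
def Near (δ : ℝ) (K L : Set X) : Prop :=
  (∀ x ∈ K, ∃ y ∈ L, dist x y ≤ δ) ∧ (∀ y ∈ L, ∃ x ∈ K, dist x y ≤ δ)

/-- the set-function version of an even continuous translation invariant valuation -/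
structure Val (ν : Set X → ℂ) : Prop where
  empty : ν ∅ = 0
  cut : ∀ K, CC K → ∀ (f : X →ₗ[ℝ] ℝ) (c : ℝ),
    ν K + ν (K ∩ {x | f x = c}) = ν (K ∩ {x | f x ≤ c}) + ν (K ∩ {x | c ≤ f x})
  trans : ∀ K, CC K → ∀ x : X, ν ((fun y => x + y) '' K) = ν K
  even : ∀ K, CC K → ν (-K) = ν K
  cont : ∀ K, CC K → K.Nonempty → ∀ ε > 0, ∃ δ > 0, ∀ L, CC L → L.Nonempty → Near δ K L →
    ‖ν L - ν K‖ < ε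

/-- vanishing on sets contained in a hyperplane -/
def Simple (ν : Set X → ℂ) : Prop :=
  ∀ K, CC K → ∀ (f : X →ₗ[ℝ] ℝ) (c : ℝ), f ≠ 0 → (∀ x ∈ K, f x = c) → ν K = 0

/-- the segment from `0` to `v` -/
def seg (v : X) : Set X := (fun t : ℝ => t • v) '' Icc 0 1

lemma cc_seg (v : X) : CC (seg v) := by
  refine ⟨?_, ?_⟩
  · have : seg v = (LinearMap.toSpanSingleton ℝ X v) '' Icc 0 1 := by
      ext; simp [seg]
    rw [this]
    exact (convex_Icc (0:ℝ) 1).linear_image _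
  · exact isCompact_Icc.image (by fun_prop)

lemma CC.add {K L : Set X} (hK : CC K) (hL : CC L) : CC (K + L) :=
  ⟨hK.1.add hL.1, hK.2.add hL.2⟩

lemma CC.neg {K : Set X} (hK : CC K) : CC (-K) := ⟨hK.1.neg, hK.2.neg⟩

lemma CC.translate {K : Set X} (hK : CC K) (x : X) : CC ((fun y => x + y) '' K) := by
  refine ⟨?_, hK.2.image (by fun_prop)⟩
  have := hK.1.translate x
  simpa using this

lemma CC.inter {K L : Set X} (hK : CC K) (hL : Convex ℝ L) (hL' : IsClosed L) : CC (K ∩ L) :=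
  ⟨hK.1.inter hL, hK.2.inter_right hL'⟩

variable [FiniteDimensional ℝ X]

lemma lin_cont (f : X →ₗ[ℝ] ℝ) : Continuous f := f.continuous_of_finiteDimensional

lemma CC.le {K : Set X} (hK : CC K) (f : X →ₗ[ℝ] ℝ) (c : ℝ) : CC (K ∩ {x | f x ≤ c}) :=
  hK.inter (convex_halfSpace_le f.isLinear c) (isClosed_le (lin_cont f) continuous_const)

lemma CC.ge {K : Set X} (hK : CC K) (f : X →ₗ[ℝ] ℝ) (c : ℝ) : CC (K ∩ {x | c ≤ f x}) :=
  hK.inter (convex_halfSpace_ge f.isLinear c) (isClosed_le continuous_const (lin_cont f))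

lemma CC.eq {K : Set X} (hK : CC K) (f : X →ₗ[ℝ] ℝ) (c : ℝ) : CC (K ∩ {x | f x = c}) :=
  hK.inter (convex_hyperplane f.isLinear c) (isClosed_eq (lin_cont f) continuous_const)

lemma simple_cut {ν : Set X → ℂ} (hV : Val ν) (hS : Simple ν) {K : Set X} (hK : CC K)
    (f : X →ₗ[ℝ] ℝ) (hf : f ≠ 0) (c : ℝ) :
    ν K = ν (K ∩ {x | f x ≤ c}) + ν (K ∩ {x | c ≤ f x}) := by
  rw [← hV.cut K hK f c, hS _ (hK.eq f c) f c hf (fun x hx => hx.2), add_zero]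

/-- prism hypothesis -/
def Prism (ν : Set X → ℂ) : Prop :=
  ∀ (f : X →ₗ[ℝ] ℝ) (v : X) (c : ℝ) (K : Set X), f v ≠ 0 → CC K → (∀ x ∈ K, f x = c) →
    ν (K + seg v) = 0

/-- bodies whose upper boundary in direction `v` is given by finitely many affine functions -/
def Top (v : X) (l : List ((X →ₗ[ℝ] ℝ) × ℝ)) (K : Set X) : Prop :=
  (∀ p ∈ l, p.1 v = 1) ∧ ∀ x ∈ K, (∀ p ∈ l, p.1 x ≤ p.2) ∧
    ∀ t : ℝ, 0 ≤ t → (∀ p ∈ l, p.1 x + t ≤ p.2) → x + t • v ∈ K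

lemma seg_cut (K : Set X) (v : X) (f : X →ₗ[ℝ] ℝ) (hf : f v = 0) (S : Set ℝ) :
    (K + seg v) ∩ {x | f x ∈ S} = (K ∩ {x | f x ∈ S}) + seg v := by
  ext x
  constructor
  · rintro ⟨⟨y, hy, _, ⟨t, ht, rfl⟩, rfl⟩, hx⟩
    refine ⟨y, ⟨hy, ?_⟩, _, ⟨t, ht, rfl⟩, rfl⟩
    simpa [hf] using hx
  · rintro ⟨y, ⟨hy, hy'⟩, _, ⟨t, ht, rfl⟩, rfl⟩
    refine ⟨⟨y, hy, _, ⟨t, ht, rfl⟩, rfl⟩, ?_⟩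
    simpa [hf] using hy'

lemma D_cut {ν : Set X → ℂ} (hV : Val ν) (hS : Simple ν) {K : Set X} (hK : CC K)
    (v : X) (f : X →ₗ[ℝ] ℝ) (hf : f ≠ 0) (hfv : f v = 0) (c : ℝ)
    (h1 : ν (K ∩ {x | f x ≤ c} + seg v) = ν (K ∩ {x | f x ≤ c}))
    (h2 : ν (K ∩ {x | c ≤ f x} + seg v) = ν (K ∩ {x | c ≤ f x})) :
    ν (K + seg v) = ν K := by
  rw [simple_cut hV hS hK f hf c, simple_cut hV hS (hK.add (cc_seg v)) f hf c, ← h1, ← h2]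
  have e1 := seg_cut K v f hfv (Iic c)
  have e2 := seg_cut K v f hfv (Ici c)
  simp only [mem_Iic, mem_Ici] at e1 e2
  rw [e1, e2]

lemma D_base {ν : Set X → ℂ} (hV : Val ν) (hS : Simple ν) (hP : Prism ν) (v : X)
    (a : (X →ₗ[ℝ] ℝ) × ℝ) {K : Set X} (hK : CC K) (hT : Top v [a] K) :
    ν (K + seg v) = ν K := by
  obtain ⟨f, c⟩ := a
  obtain ⟨h1, h2⟩ := hT
  simp only [List.mem_singleton, forall_eq] at h1 h2
  have hf : f ≠ 0 := by rintro rfl; simp at h1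
  rw [simple_cut hV hS (hK.add (cc_seg v)) f hf c]
  have e1 : (K + seg v) ∩ {x | f x ≤ c} = K := by
    ext x
    constructor
    · rintro ⟨⟨y, hy, _, ⟨t, ht, rfl⟩, rfl⟩, hx⟩
      refine (h2 y hy).2 t ht.1 ?_
      simpa [h1] using hx
    · intro hx
      exact ⟨⟨x, hx, 0, ⟨0, by simp, by simp⟩, by simp⟩, (h2 x hx).1⟩
  have e2 : (K + seg v) ∩ {x | c ≤ f x} = (K ∩ {x | f x = c}) + seg v := by
    ext x
    constructor
    · rintro ⟨⟨y, hy, _, ⟨t, ht, rfl⟩, rfl⟩, hx⟩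
      have hx' : c ≤ f y + t := by simpa [h1] using hx
      have hy1 := (h2 y hy).1
      refine ⟨y + (c - f y) • v, ⟨(h2 y hy).2 _ (by linarith) (by linarith), by simp [h1]⟩,
        _, ⟨t - (c - f y), ⟨by linarith, by linarith [ht.2]⟩, rfl⟩, ?_⟩
      simp only [sub_smul]; abel
    · rintro ⟨y, ⟨hy, hy'⟩, _, ⟨t, ht, rfl⟩, rfl⟩
      refine ⟨⟨y, hy, _, ⟨t, ht, rfl⟩, rfl⟩, ?_⟩
      have hy' : f y = c := hy'
      simp [h1, hy', ht.1]
  rw [e1, e2, hP f v c _ (by simp [h1]) (hK.eq f c) (fun x hx => hx.2), add_zero]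

lemma D_top {ν : Set X → ℂ} (hV : Val ν) (hS : Simple ν) (hP : Prism ν) (v : X)
    (l : List ((X →ₗ[ℝ] ℝ) × ℝ)) : ∀ (a : (X →ₗ[ℝ] ℝ) × ℝ) (K : Set X), CC K →
    Top v (a :: l) K → ν (K + seg v) = ν K := by
  induction l with
  | nil => intro a K hK hT; exact D_base hV hS hP v a hK hT
  | cons b l ih =>
    intro a K hK hT
    obtain ⟨h1, h2⟩ := hT
    simp only [List.mem_cons, forall_eq_or_imp] at h1 h2
    obtain ⟨ha, hb, hl⟩ := h1
    have key1 : ∀ S : Set X, S ⊆ K → (∀ x ∈ S, ∀ t : ℝ, x + t • v ∈ K → x + t • v ∈ S) →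
        (∀ x ∈ S, a.1 x - b.1 x ≤ a.2 - b.2) → Top v (b :: l) S := by
      intro S hSK hSt hSle
      refine ⟨?_, ?_⟩
      · simp only [List.mem_cons, forall_eq_or_imp]; exact ⟨hb, hl⟩
      intro x hx
      simp only [List.mem_cons, forall_eq_or_imp]
      refine ⟨(h2 x (hSK hx)).1.2, ?_⟩
      rintro t ht ⟨h3, h4⟩
      exact hSt x hx t ((h2 x (hSK hx)).2 t ht ⟨by linarith [hSle x hx], h3, h4⟩)
    have key2 : ∀ S : Set X, S ⊆ K → (∀ x ∈ S, ∀ t : ℝ, x + t • v ∈ K → x + t • v ∈ S) →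
        (∀ x ∈ S, a.2 - b.2 ≤ a.1 x - b.1 x) → Top v (a :: l) S := by
      intro S hSK hSt hSle
      refine ⟨?_, ?_⟩
      · simp only [List.mem_cons, forall_eq_or_imp]; exact ⟨ha, hl⟩
      intro x hx
      simp only [List.mem_cons, forall_eq_or_imp]
      refine ⟨⟨(h2 x (hSK hx)).1.1, (h2 x (hSK hx)).1.2.2⟩, ?_⟩
      rintro t ht ⟨h3, h4⟩
      exact hSt x hx t ((h2 x (hSK hx)).2 t ht ⟨h3, by linarith [hSle x hx], h4⟩)
    by_cases hg : a.1 - b.1 = 0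
    · have hg' : ∀ x, a.1 x - b.1 x = 0 := fun x => by
        rw [← LinearMap.sub_apply, hg]; rfl
      rcases le_total 0 (a.2 - b.2) with h | h
      · exact ih b K hK (key1 K subset_rfl (fun _ _ _ h => h) (fun x _ => by rw [hg']; exact h))
      · exact ih a K hK (key2 K subset_rfl (fun _ _ _ h => h) (fun x _ => by rw [hg']; exact h))
    · refine D_cut hV hS hK v (a.1 - b.1) hg (by simp [ha, hb]) (a.2 - b.2) ?_ ?_
      · refine ih b _ (hK.le _ _) (key1 _ inter_subset_left ?_ (fun x hx => by simpa using hx.2))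
        intro x hx t h
        refine ⟨h, ?_⟩
        have := hx.2
        simp only [mem_ofPred_eq, LinearMap.sub_apply, map_add, map_smul, smul_eq_mul, ha, hb] at *
        linarith
      · refine ih a _ (hK.ge _ _) (key2 _ inter_subset_left ?_ (fun x hx => by simpa using hx.2))
        intro x hx t h
        refine ⟨h, ?_⟩
        have := hx.2
        simp only [mem_ofPred_eq, LinearMap.sub_apply, map_add, map_smul, smul_eq_mul, ha, hb] at *
        linarith

lemma exists_sep {K : Set X} (hK : CC K) (v : X) (x k : X) (s : ℝ) (hs : 0 ≤ s)
    (hk : k ∈ K) (hx : x = k + s • v) (hxK : x ∉ K) :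
    ∃ p : (X →ₗ[ℝ] ℝ) × ℝ, p.1 v = 1 ∧ (∀ y ∈ K, p.1 y ≤ p.2) ∧ p.2 < p.1 x := by
  set R : Set X := (fun t : ℝ => t • (-v)) '' Ici 0 with hR
  have hRc : Convex ℝ R := by
    have : R = (LinearMap.toSpanSingleton ℝ X (-v)) '' Ici 0 := by
      ext; simp [hR]
    rw [this]
    exact (convex_Ici (0:ℝ)).linear_image _
  have hv : v ≠ 0 := by
    rintro rfl; simp at hx; exact hxK (hx ▸ hk)
  have hRcl : IsClosed R := by
    have hc : Topology.IsClosedEmbedding (fun t : ℝ => t • (-v)) :=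
      isClosedEmbedding_smul_left (neg_ne_zero.2 hv)
    exact hc.isClosedMap _ isClosed_Ici
  have hcl : IsClosed (R + K) := hRcl.add_right_of_isCompact hK.2
  have hxs : x ∉ R + K := by
    rintro ⟨_, ⟨t, ht, rfl⟩, y, hy, hxy⟩
    have ht : 0 ≤ t := ht
    simp only at hxy
    apply hxK
    rcases (add_nonneg hs ht).eq_or_lt with h0 | h0
    · have : s = 0 := by linarith
      simp [this] at hx; exact hx ▸ hk
    have h3 : y = k + (s + t) • v := by
      have : y = x + t • v := by rw [← hxy]; simp
      rw [this, hx, add_smul]; abel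
    have := hK.1 hk hy (show 0 ≤ t / (s + t) by positivity)
      (show 0 ≤ s / (s + t) by positivity)
      (by field_simp; ring)
    convert this using 1
    rw [h3, hx, smul_add, ← add_assoc, ← add_smul, smul_smul]
    have e1 : t / (s + t) + s / (s + t) = 1 := by field_simp; ring
    have e2 : s / (s + t) * (s + t) = s := by field_simp
    rw [e1, e2, one_smul]
  obtain ⟨f, u, hf1, hf2⟩ := geometric_hahn_banach_closed_point (hRc.add hK.1) hcl hxs
  have hfK : ∀ y ∈ K, f y < u := fun y hy =>
    hf1 y ⟨0, ⟨0, by simp, by simp⟩, y, hy, by simp⟩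
  have hfv : 0 < f v := by
    by_contra hneg
    push Not at hneg
    have := hfK k hk
    rw [hx] at hf2
    simp at hf2
    nlinarith
  refine ⟨⟨(f v)⁻¹ • (f : X →ₗ[ℝ] ℝ), (f v)⁻¹ * u⟩, ?_, ?_, ?_⟩
  · simp [hfv.ne']
  · intro y hy
    simp only [LinearMap.smul_apply, ContinuousLinearMap.coe_coe, smul_eq_mul]
    exact mul_le_mul_of_nonneg_left (hfK y hy).le (inv_nonneg.2 hfv.le)
  · simp only [LinearMap.smul_apply, ContinuousLinearMap.coe_coe, smul_eq_mul]
    exact mul_lt_mul_of_pos_left hf2 (inv_pos.2 hfv)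

lemma exists_top {K : Set X} (hK : CC K) (hne : K.Nonempty) (v : X) (hv : v ≠ 0) (ε : ℝ)
    (hε : 0 < ε) : ∃ a l K', CC K' ∧ Top v (a :: l) K' ∧ K ⊆ K' ∧
      ∀ x ∈ K', ∃ y ∈ K, dist x y ≤ ε := by
  let f1 : X →ₗ[ℝ] ℝ := (‖v‖ ^ 2)⁻¹ • (innerₗ X v)
  have hf1v : f1 v = 1 := by
    simp [f1, real_inner_self_eq_norm_sq, hv]
  obtain ⟨kM, hkM, hM⟩ := hK.2.exists_isMaxOn hne (lin_cont f1).continuousOn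
  obtain ⟨km, hkm, hm⟩ := hK.2.exists_isMinOn hne (lin_cont f1).continuousOn
  rw [isMaxOn_iff] at hM
  rw [isMinOn_iff] at hm
  set c1 := f1 kM with hc1
  set T := c1 - f1 km with hT
  have hT0 : 0 ≤ T := by have := hM km hkm; linarith
  set A : Set X := (K + seg (T • v)) ∩ {x | f1 x ≤ c1} with hA
  have hAcc : CC A := (hK.add (cc_seg _)).le _ _
  set B : Set X := A ∩ {x | ε ≤ infDist x K} with hB
  have hBc : IsCompact B :=
    hAcc.2.inter_right (isClosed_le continuous_const (continuous_infDist_pt K))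
  have key : ∃ l : List ((X →ₗ[ℝ] ℝ) × ℝ), (∀ p ∈ l, p.1 v = 1 ∧ ∀ k ∈ K, p.1 k ≤ p.2) ∧
      ∀ x ∈ B, ∃ p ∈ l, p.2 < p.1 x := by
    refine hBc.induction_on (p := fun S => ∃ l : List ((X →ₗ[ℝ] ℝ) × ℝ),
      (∀ p ∈ l, p.1 v = 1 ∧ ∀ k ∈ K, p.1 k ≤ p.2) ∧ ∀ x ∈ S, ∃ p ∈ l, p.2 < p.1 x)
      ⟨[], by simp, by simp⟩ ?_ ?_ ?_
    · rintro s t hst ⟨l, h1, h2⟩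
      exact ⟨l, h1, fun x hx => h2 x (hst hx)⟩
    · rintro s t ⟨l, h1, h2⟩ ⟨l', h1', h2'⟩
      refine ⟨l ++ l', ?_, ?_⟩
      · intro p hp
        rcases List.mem_append.1 hp with h | h
        · exact h1 p h
        · exact h1' p h
      · rintro x (hx | hx)
        · obtain ⟨p, hp, hp'⟩ := h2 x hx
          exact ⟨p, List.mem_append_left _ hp, hp'⟩
        · obtain ⟨p, hp, hp'⟩ := h2' x hx
          exact ⟨p, List.mem_append_right _ hp, hp'⟩
    · rintro x ⟨⟨⟨k, hk, _, ⟨t, ht, rfl⟩, hx1⟩, hx2⟩, hx3⟩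
      have hxK : x ∉ K := by
        intro h
        have := infDist_zero_of_mem h
        simp only [mem_ofPred_eq] at hx3
        linarith
      obtain ⟨p, hp1, hp2, hp3⟩ := exists_sep hK v x k (t * T) (mul_nonneg ht.1 hT0) hk
        (by rw [← hx1]; simp [smul_smul]) hxK
      refine ⟨{y | p.2 < p.1 y}, mem_nhdsWithin_of_mem_nhds
        ((isOpen_lt continuous_const (lin_cont p.1)).mem_nhds hp3), [p], ?_, ?_⟩
      · simp only [List.mem_singleton, forall_eq]
        exact ⟨hp1, hp2⟩
      · intro y hy
        exact ⟨p, by simp, hy⟩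
  obtain ⟨l, hl1, hl2⟩ := key
  have hcl : ∀ l : List ((X →ₗ[ℝ] ℝ) × ℝ), CC (A ∩ {x | ∀ p ∈ l, p.1 x ≤ p.2}) := by
    intro l
    induction l with
    | nil => simpa using hAcc
    | cons b l ih =>
      convert ih.le b.1 b.2 using 1
      ext x; simp only [List.mem_cons, forall_eq_or_imp, mem_inter_iff, mem_ofPred_eq]; tauto
  refine ⟨(f1, c1), l, A ∩ {x | ∀ p ∈ l, p.1 x ≤ p.2}, hcl l, ⟨?_, ?_⟩, ?_, ?_⟩
  · simp only [List.mem_cons, forall_eq_or_imp]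
    exact ⟨hf1v, fun p hp => (hl1 p hp).1⟩
  · rintro x ⟨⟨⟨k, hk, _, ⟨s, hs, rfl⟩, rfl⟩, hx2⟩, hx3⟩
    simp only [List.mem_cons, forall_eq_or_imp]
    refine ⟨⟨hx2, hx3⟩, ?_⟩
    rintro t ht ⟨h1, h2⟩
    have hsum : f1 k + s * T + t ≤ c1 := by
      simpa [hf1v] using h1
    have hkm' := hm k hk
    have hs0 := mul_nonneg hs.1 hT0
    refine ⟨⟨?_, ?_⟩, ?_⟩
    · refine ⟨k, hk, (s * T + t) • v, ?_, ?_⟩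
      · rcases hT0.eq_or_lt with h0 | h0
        · refine ⟨0, by simp, ?_⟩
          have : s * T + t = 0 := by
            rw [← h0] at hT hsum hs0 ⊢
            simp at *
            linarith
          simp [this]
        · refine ⟨(s * T + t) / T, ⟨by positivity, ?_⟩, ?_⟩
          · rw [div_le_one h0]; linarith
          · simp only [smul_smul]; congr 1; field_simp
      · simp only [smul_smul, add_smul]; abel
    · simpa [hf1v] using h1
    · intro p hp
      have := h2 p hp
      simpa [(hl1 p hp).1] using this
  · intro k hk
    refine ⟨⟨⟨k, hk, 0, ⟨0, by simp, by simp⟩, by simp⟩, hM k hk⟩, fun p hp => (hl1 p hp).2 k hk⟩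
  · rintro x ⟨hxA, hxl⟩
    have hlt : infDist x K < ε := by
      by_contra h
      push Not at h
      obtain ⟨p, hp, hp'⟩ := hl2 x ⟨hxA, h⟩
      have := hxl p hp
      linarith
    obtain ⟨y, hy, hy'⟩ := (infDist_lt_iff hne).1 hlt
    exact ⟨y, hy, hy'.le⟩

lemma Near.add {δ ε : ℝ} {K L K' L' : Set X} (h : Near δ K L) (h' : Near ε K' L') :
    Near (δ + ε) (K + K') (L + L') := by
  constructor
  · rintro _ ⟨x, hx, x', hx', rfl⟩
    obtain ⟨y, hy, hxy⟩ := h.1 x hx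
    obtain ⟨y', hy', hxy'⟩ := h'.1 x' hx'
    exact ⟨_, ⟨y, hy, y', hy', rfl⟩, (dist_add_add_le _ _ _ _).trans (add_le_add hxy hxy')⟩
  · rintro _ ⟨x, hx, x', hx', rfl⟩
    obtain ⟨y, hy, hxy⟩ := h.2 x hx
    obtain ⟨y', hy', hxy'⟩ := h'.2 x' hx'
    exact ⟨_, ⟨y, hy, y', hy', rfl⟩, (dist_add_add_le _ _ _ _).trans (add_le_add hxy hxy')⟩

lemma Near.refl (K : Set X) : Near 0 K K :=
  ⟨fun x hx => ⟨x, hx, by simp⟩, fun x hx => ⟨x, hx, by simp⟩⟩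

lemma Near.mono {δ ε : ℝ} {K L : Set X} (h : Near δ K L) (hde : δ ≤ ε) : Near ε K L :=
  ⟨fun x hx => (h.1 x hx).imp fun _ hy => ⟨hy.1, hy.2.trans hde⟩,
   fun x hx => (h.2 x hx).imp fun _ hy => ⟨hy.1, hy.2.trans hde⟩⟩

lemma seg_nonempty (v : X) : (seg v).Nonempty := ⟨0, 0, by simp, by simp⟩

/-- approximation principle -/
lemma Val.approx {ν : Set X → ℂ} (hV : Val ν) {K K' : Set X} (hK : CC K) (hne : K.Nonempty)
    (hK' : CC K') (hne' : K'.Nonempty)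
    (h : ∀ δ > 0, ∃ L L', CC L ∧ L.Nonempty ∧ CC L' ∧ L'.Nonempty ∧ Near δ K L ∧ Near δ K' L' ∧
      ν L = ν L') : ν K = ν K' := by
  by_contra hcon
  have hpos : 0 < ‖ν K - ν K'‖ := norm_pos_iff.2 (sub_ne_zero.2 hcon)
  obtain ⟨δ, hδ, h1⟩ := hV.cont K hK hne (‖ν K - ν K'‖ / 2) (by positivity)
  obtain ⟨δ', hδ', h2⟩ := hV.cont K' hK' hne' (‖ν K - ν K'‖ / 2) (by positivity)
  obtain ⟨L, L', hL, hLn, hL', hLn', hn, hn', he⟩ := h (min δ δ') (lt_min hδ hδ')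
  have e1 := h1 L hL hLn (hn.mono (min_le_left _ _))
  have e2 := h2 L' hL' hLn' (hn'.mono (min_le_right _ _))
  have : ‖ν K - ν K'‖ ≤ ‖ν L - ν K‖ + ‖ν L' - ν K'‖ := by
    rw [he, norm_sub_rev (ν L') (ν K)]
    have := norm_add_le (ν K - ν L') (ν L' - ν K')
    simpa using this
  linarith

lemma add_seg {ν : Set X → ℂ} (hV : Val ν) (hS : Simple ν) (hP : Prism ν) (v : X)
    {K : Set X} (hK : CC K) : ν (K + seg v) = ν K := by
  rcases K.eq_empty_or_nonempty with rfl | hne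
  · simp
  by_cases hv : v = 0
  · subst hv
    have : seg (0 : X) = {0} := by
      ext x; simp only [seg, smul_zero, mem_image, mem_singleton_iff]
      exact ⟨fun ⟨_, _, h⟩ => h.symm, fun h => ⟨0, by simp, h.symm⟩⟩
    rw [this]; simp
  refine hV.approx (hK.add (cc_seg v)) (hne.add (seg_nonempty v)) hK hne ?_
  intro δ hδ
  obtain ⟨a, l, L, hL, hT, hKL, hn⟩ := exists_top hK hne v hv δ hδ
  have hnear : Near δ K L := ⟨fun x hx => ⟨x, hKL hx, by simpa using hδ.le⟩, fun y hy => by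
    obtain ⟨x, hx, h⟩ := hn y hy
    exact ⟨x, hx, by rwa [dist_comm]⟩⟩
  refine ⟨L + seg v, L, hL.add (cc_seg v), (hne.mono hKL).add (seg_nonempty v), hL,
    hne.mono hKL, ?_, hnear, D_top hV hS hP v l a L hL hT⟩
  simpa using hnear.add (Near.refl (seg v))

end KlainVal

namespace KlainVal
set_option linter.unusedSectionVars false
variable {X : Type*} [NormedAddCommGroup X] [InnerProductSpace ℝ X] [FiniteDimensional ℝ X]

/-- a steep downward cone -/
def cone (e : X) (η : ℝ) : Set X := {w | ‖w‖ ≤ -((1 + η) * innerₗ X e w)}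

lemma cone_closed (e : X) (η : ℝ) : IsClosed (cone e η) :=
  isClosed_le continuous_norm (((lin_cont (innerₗ X e)).const_mul _).neg)

lemma cone_convex (e : X) (η : ℝ) : Convex ℝ (cone e η) := by
  intro x hx y hy a b ha hb hab
  simp only [cone, mem_ofPred_eq, map_add, map_smul, smul_eq_mul] at *
  calc ‖a • x + b • y‖ ≤ ‖a • x‖ + ‖b • y‖ := norm_add_le _ _
    _ = a * ‖x‖ + b * ‖y‖ := by rw [norm_smul, norm_smul, Real.norm_of_nonneg ha, Real.norm_of_nonneg hb]
    _ ≤ _ := by nlinarith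

lemma addcone_closed {K : Set X} (hK : CC K) (e : X) (η : ℝ) : IsClosed (K + cone e η) := by
  rw [add_comm]; exact (cone_closed e η).add_right_of_isCompact hK.2

lemma addcone_convex {K : Set X} (hK : CC K) (e : X) (η : ℝ) : Convex ℝ (K + cone e η) :=
  hK.1.add (cone_convex e η)

lemma exists_bound {K : Set X} (hK : CC K) : ∃ R, 0 ≤ R ∧ ∀ x ∈ K, ‖x‖ ≤ R := by
  obtain ⟨R, hR⟩ := hK.2.isBounded.exists_norm_le
  exact ⟨max R 0, le_max_right _ _, fun x hx => (hR x hx).trans (le_max_left _ _)⟩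

lemma inner_le_norm' {e : X} (he : ‖e‖ = 1) (x : X) : |innerₗ X e x| ≤ ‖x‖ := by
  have := abs_real_inner_le_norm e x
  simpa [he] using this

lemma cc_cap {K : Set X} (hK : CC K) {e : X} (he : ‖e‖ = 1) {η : ℝ} (hη : 0 < η) (c : ℝ) :
    CC ((K + cone e η) ∩ {x | c ≤ innerₗ X e x}) := by
  refine ⟨(addcone_convex hK e η).inter (convex_halfSpace_ge (innerₗ X e).isLinear c), ?_⟩
  obtain ⟨R, hR0, hR⟩ := exists_bound hK
  refine Metric.isCompact_of_isClosed_isBounded ((addcone_closed hK e η).inter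
    (isClosed_le continuous_const (lin_cont _))) ?_
  refine (Metric.isBounded_closedBall (x := (0:X)) (r := R + (1 + η) * (R - c))).subset ?_
  rintro _ ⟨⟨k, hk, w, hw, rfl⟩, hx⟩
  simp only [mem_ofPred_eq, cone, map_add, mem_closedBall_zero_iff] at *
  have h1 := hR k hk
  have h2 := (abs_le.1 (inner_le_norm' he k)).2
  have h3 := norm_add_le k w
  nlinarith

lemma cap_zero {ν : Set X → ℂ} (hV : Val ν) (hS : Simple ν)
    (hsym : ∀ S, CC S → -S = S → ν S = 0) {K : Set X} (hK : CC K) (hne : K.Nonempty)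
    {e : X} (he : ‖e‖ = 1) {η : ℝ} (hη : 0 < η) (c : ℝ) :
    ν ((K + cone e η) ∩ {x | c ≤ innerₗ X e x}) = 0 := by
  set f := innerₗ X e with hf
  have hfe : f e = 1 := by simp [hf, he]
  have hf0 : f ≠ 0 := by intro h; rw [h] at hfe; simp at hfe
  have hcap := cc_cap hK he hη c
  obtain ⟨R, hR0, hR⟩ := exists_bound hK
  obtain ⟨R', hR0', hR'⟩ := exists_bound hcap
  obtain ⟨k0, hk0⟩ := hne
  set r : ℝ := (2 + η) * (R + R') / (2 * η) + |c| with hr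
  have hr1 : (2 + η) * (R + R') ≤ 2 * η * r := by
    rw [hr, mul_add (2 * η)]
    have : 2 * η * ((2 + η) * (R + R') / (2 * η)) = (2 + η) * (R + R') := by field_simp
    rw [this]
    have := abs_nonneg c
    nlinarith
  have hr2 : 0 ≤ c + r := by
    rw [hr]
    have := neg_abs_le c
    have : 0 ≤ (2 + η) * (R + R') / (2 * η) := by positivity
    linarith
  set K1 : Set X := (fun y => r • e + y) '' K with hK1
  have hK1cc : CC K1 := hK.translate _
  set cap : Set X := (K1 + cone e η) ∩ {x | c + r ≤ f x} with hcapdef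
  have hcape : cap = (fun y => r • e + y) '' ((K + cone e η) ∩ {x | c ≤ f x}) := by
    ext x
    constructor
    · rintro ⟨⟨_, ⟨k, hk, rfl⟩, w, hw, rfl⟩, hx⟩
      refine ⟨k + w, ⟨⟨k, hk, w, hw, rfl⟩, ?_⟩, by simp [add_assoc]⟩
      simp only [mem_ofPred_eq, map_add, map_smul, hfe, smul_eq_mul] at hx ⊢
      linarith
    · rintro ⟨_, ⟨⟨k, hk, w, hw, rfl⟩, hx⟩, rfl⟩
      refine ⟨⟨_, ⟨k, hk, rfl⟩, w, hw, by simp [add_assoc]⟩, ?_⟩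
      simp only [mem_ofPred_eq, map_add, map_smul, hfe, smul_eq_mul] at hx ⊢
      linarith
  have hcapν : ν cap = ν ((K + cone e η) ∩ {x | c ≤ f x}) := by
    rw [hcape, hV.trans _ hcap]
  rw [← hcapν]
  set G := K1 + cone e η with hG
  obtain ⟨R1, hR10, hR1⟩ := exists_bound hK1cc
  have hGf : ∀ x ∈ G, f x ≤ R1 := by
    rintro _ ⟨k, hk, w, hw, rfl⟩
    have h1 := hR1 k hk
    have h2 := (abs_le.1 (inner_le_norm' he k)).2
    have h3 : ‖w‖ ≤ -((1 + η) * f w) := hw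
    have h4 := norm_nonneg w
    have : f w ≤ 0 := by
      by_contra h
      push Not at h
      nlinarith
    rw [map_add]
    linarith
  set S := G ∩ -G with hSdef
  have hScc : CC S := by
    have : S = (G ∩ {x | -R1 ≤ f x}) ∩ -G := by
      ext x
      constructor
      · rintro ⟨h1, h2⟩
        refine ⟨⟨h1, ?_⟩, h2⟩
        have := hGf _ h2
        simp only [map_neg] at this
        simp only [mem_ofPred_eq]; linarith
      · rintro ⟨⟨h1, _⟩, h2⟩
        exact ⟨h1, h2⟩
    rw [this]
    exact (cc_cap hK1cc he hη _).inter (addcone_convex hK1cc e η).neg (addcone_closed hK1cc e η).neg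
  have hSneg : ∀ x, x ∈ S ↔ -x ∈ S := by
    intro x; simp only [hSdef, mem_inter_iff, mem_neg, neg_neg]; tauto
  have hSs : -S = S := by
    ext x; rw [mem_neg, ← hSneg]
  have hcapS : S ∩ {x | c + r ≤ f x} = cap := by
    ext x
    constructor
    · rintro ⟨⟨h1, _⟩, h2⟩; exact ⟨h1, h2⟩
    · intro hx
      have hx0 := hx
      obtain ⟨h1, h2⟩ := hx
      refine ⟨⟨h1, ?_⟩, h2⟩
      rw [hcape] at hx0
      obtain ⟨x', hx', rfl⟩ := hx0
      refine ⟨r • e + k0, ⟨k0, hk0, rfl⟩, -(r • e + x') - (r • e + k0), ?_, by simp only; module⟩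
      have e1 : -(r • e + x') - (r • e + k0) = -((2 * r) • e + (x' + k0)) := by
        module
      rw [e1]
      have hrn : 0 ≤ r := by
        have : 0 ≤ (2 + η) * (R + R') := by positivity
        by_contra h
        push Not at h
        nlinarith
      simp only [cone, mem_ofPred_eq, norm_neg, map_neg]
      rw [← hf, map_add, map_smul, hfe, smul_eq_mul]
      have h3 : ‖(2 * r) • e + (x' + k0)‖ ≤ 2 * r + ‖x' + k0‖ := by
        refine (norm_add_le _ _).trans ?_
        rw [norm_smul, he, Real.norm_of_nonneg (by positivity)]; simp
      have h4 : ‖x' + k0‖ ≤ R + R' := by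
        have := norm_add_le x' k0
        have := hR k0 hk0
        have := hR' x' hx'
        linarith
      have h5 := (abs_le.1 (inner_le_norm' he (x' + k0))).1
      rw [← hf] at h5
      nlinarith
  have h1 := simple_cut hV hS hScc f hf0 (c + r)
  rw [hsym S hScc hSs, hcapS] at h1
  have hcc2 := hScc.le f (c + r)
  have h2 := simple_cut hV hS hcc2 f hf0 (-(c + r))
  have h3 : S ∩ {x | f x ≤ c + r} ∩ {x | f x ≤ -(c + r)} = -cap := by
    rw [← hcapS]
    ext x
    simp only [mem_inter_iff, mem_neg, mem_ofPred_eq, map_neg, ← hSneg x]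
    constructor
    · rintro ⟨⟨a, b⟩, d⟩; exact ⟨a, by linarith⟩
    · rintro ⟨a, b⟩; exact ⟨⟨a, by linarith⟩, by linarith⟩
  have h4 : ν (S ∩ {x | f x ≤ c + r} ∩ {x | -(c + r) ≤ f x}) = 0 := by
    refine hsym _ (hcc2.ge _ _) ?_
    ext x
    simp only [mem_inter_iff, mem_neg, mem_ofPred_eq, map_neg, ← hSneg x]
    constructor
    · rintro ⟨⟨a, b⟩, d⟩; exact ⟨⟨a, by linarith⟩, by linarith⟩
    · rintro ⟨⟨a, b⟩, d⟩; exact ⟨⟨a, by linarith⟩, by linarith⟩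
  have hcapcc : CC cap := by rw [← hcapS]; exact hScc.ge _ _
  rw [h3, h4, hV.even cap hcapcc, add_zero] at h2
  rw [h2] at h1
  have : (2 : ℂ) * ν cap = 0 := by rw [two_mul]; exact h1.symm
  simpa using this

lemma flat_zero {ν : Set X → ℂ} (hV : Val ν) (hS : Simple ν)
    (hsym : ∀ S, CC S → -S = S → ν S = 0) {K : Set X} (hK : CC K) (hne : K.Nonempty)
    {e : X} (he : ‖e‖ = 1) (c T : ℝ) (hc : ∀ x ∈ K, c ≤ innerₗ X e x)
    (hT : ∀ x ∈ K, innerₗ X e x - c ≤ T) :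
    ν ((K + seg ((-T) • e)) ∩ {x | c ≤ innerₗ X e x}) = 0 := by
  have h0cc : CC ({0} : Set X) := ⟨convex_singleton 0, isCompact_singleton⟩
  have h0 : ν ({0} : Set X) = 0 := hsym _ h0cc (by simp)
  rw [← h0]
  set f := innerₗ X e with hf
  have hfe : f e = 1 := by simp [hf, he]
  obtain ⟨k0, hk0⟩ := hne
  have hT0 : 0 ≤ T := by linarith [hc k0 hk0, hT k0 hk0]
  have hne2 : ((K + seg ((-T) • e)) ∩ {x | c ≤ f x}).Nonempty :=
    ⟨k0, ⟨k0, hk0, 0, ⟨0, by simp, by simp⟩, by simp⟩, hc k0 hk0⟩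
  refine hV.approx ((hK.add (cc_seg _)).ge f c) hne2 h0cc (by simp) ?_
  intro δ hδ
  set η := min 1 (δ ^ 2 / (3 * T ^ 2 + 1)) with hη
  have hη0 : 0 < η := by rw [hη]; exact lt_min one_pos (by positivity)
  have hη1 : η ≤ 1 := min_le_left _ _
  have hη2 : 3 * η * T ^ 2 ≤ δ ^ 2 := by
    have h1 : η ≤ δ ^ 2 / (3 * T ^ 2 + 1) := min_le_right _ _
    rw [le_div_iff₀ (by positivity)] at h1
    nlinarith
  have hsub : (K + seg ((-T) • e)) ∩ {x | c ≤ f x} ⊆ (K + cone e η) ∩ {x | c ≤ f x} := by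
    rintro _ ⟨⟨k, hk, _, ⟨t, ht, rfl⟩, rfl⟩, hx⟩
    refine ⟨⟨k, hk, _, ?_, rfl⟩, hx⟩
    simp only [cone, mem_ofPred_eq]
    rw [← hf, map_smul, map_smul, hfe, norm_smul, norm_smul, he, Real.norm_of_nonneg ht.1,
      Real.norm_eq_abs, abs_neg, abs_of_nonneg hT0]
    simp only [smul_eq_mul]
    have : 0 ≤ t * T := mul_nonneg ht.1 hT0
    nlinarith
  refine ⟨_, {0}, cc_cap hK he hη0 c, hne2.mono hsub, h0cc, by simp,
    ⟨fun x hx => ⟨x, hsub hx, by simpa using hδ.le⟩, ?_⟩, (Near.refl _).mono hδ.le, ?_⟩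
  · rintro _ ⟨⟨k, hk, w, hw, rfl⟩, hx⟩
    have hw' : ‖w‖ ≤ -((1 + η) * f w) := hw
    have hx' : c ≤ f k + f w := by rw [← map_add]; exact hx
    have hw0 : f w ≤ 0 := by
      by_contra h
      push Not at h
      have := norm_nonneg w
      nlinarith
    have hwT : -f w ≤ T := by linarith [hT k hk]
    refine ⟨k + f w • e, ⟨⟨k, hk, f w • e, ?_, rfl⟩, ?_⟩, ?_⟩
    · rcases hT0.eq_or_lt with h | h
      · refine ⟨0, by simp, ?_⟩
        have : f w = 0 := by linarith
        simp [this]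
      · refine ⟨-f w / T, ⟨div_nonneg (by linarith) hT0, (div_le_one h).2 hwT⟩, ?_⟩
        simp only [smul_smul]; congr 1; field_simp
    · simp only [mem_ofPred_eq, map_add, map_smul, hfe, smul_eq_mul, mul_one]
      exact hx'
    · rw [dist_add_left, dist_eq_norm, norm_sub_rev]
      have e1 : ‖w - f w • e‖ ^ 2 = ‖w‖ ^ 2 - (f w) ^ 2 := by
        rw [norm_sub_sq_real, norm_smul, he, inner_smul_right, real_inner_comm]
        have : inner ℝ e w = f w := by simp [hf]
        rw [this, mul_one, Real.norm_eq_abs, sq_abs]; ring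
      have e2 : ‖w‖ ^ 2 ≤ ((1 + η) * f w) ^ 2 := by
        have := norm_nonneg w
        nlinarith
      have e3 : (f w) ^ 2 ≤ T ^ 2 := by nlinarith
      have e4 : ‖w - f w • e‖ ^ 2 ≤ δ ^ 2 := by
        rw [e1]
        have h5 : η ^ 2 ≤ η := by nlinarith
        have h6 : (2 * η + η ^ 2) * (f w) ^ 2 ≤ 3 * η * T ^ 2 := by
          apply mul_le_mul (by linarith) e3 (sq_nonneg _) (by positivity)
        nlinarith
      exact (pow_le_pow_iff_left₀ (norm_nonneg _) hδ.le two_ne_zero).1 e4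
  · rw [cap_zero hV hS hsym hK ⟨k0, hk0⟩ he hη0 c, h0]

lemma zero_of_sym {ν : Set X → ℂ} (hV : Val ν) (hS : Simple ν)
    (hA : ∀ v K, CC K → ν (K + seg v) = ν K)
    (hsym : ∀ S, CC S → -S = S → ν S = 0) [Nontrivial X] {K : Set X} (hK : CC K) : ν K = 0 := by
  rcases K.eq_empty_or_nonempty with rfl | hne
  · exact hV.empty
  obtain ⟨e, he⟩ : ∃ e : X, ‖e‖ = 1 := exists_norm_eq X zero_le_one
  set f := innerₗ X e with hf
  have hfe : f e = 1 := by simp [hf, he]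
  have hf0 : f ≠ 0 := by intro h; rw [h] at hfe; simp at hfe
  obtain ⟨kM, hkM, hM⟩ := hK.2.exists_isMaxOn hne (lin_cont f).continuousOn
  obtain ⟨km, hkm, hm⟩ := hK.2.exists_isMinOn hne (lin_cont f).continuousOn
  rw [isMaxOn_iff] at hM
  rw [isMinOn_iff] at hm
  set c := f km
  set T := f kM - f km with hT
  rw [← hA ((-T) • e) K hK, simple_cut hV hS (hK.add (cc_seg _)) f hf0 c,
    flat_zero hV hS hsym hK hne he c T hm (fun x hx => by have := hM x hx; rw [← hf]; linarith),
    add_zero, ← hV.even _ ((hK.add (cc_seg _)).le _ _)]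
  have hcc : CC ((fun y => T • e + y) '' (-K)) := hK.neg.translate _
  have h2 := flat_zero hV hS hsym hcc (hne.neg.image _) he (-c) T ?_ ?_
  · rw [← h2]
    congr 1
    ext x
    constructor
    · rintro ⟨⟨k, hk, _, ⟨t, ht, rfl⟩, hx1⟩, hx2⟩
      refine ⟨⟨_, ⟨-k, by simpa using hk, rfl⟩, _, ⟨1 - t, ⟨by linarith [ht.2], by linarith [ht.1]⟩, rfl⟩, ?_⟩, ?_⟩
      · have : x = -(k + t • (-T) • e) := by rw [← neg_neg x, ← hx1]
        rw [this]
        simp only; module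
      · simp only [mem_ofPred_eq, map_neg] at hx2 ⊢
        rw [← hf]; linarith
    · rintro ⟨⟨_, ⟨k, hk, rfl⟩, _, ⟨t, ht, rfl⟩, rfl⟩, hx⟩
      refine ⟨⟨-k, hk, _, ⟨1 - t, ⟨by linarith [ht.2], by linarith [ht.1]⟩, rfl⟩, ?_⟩, ?_⟩
      · simp only; module
      · rw [mem_ofPred_eq, map_neg]
        have : -c ≤ f _ := hx
        linarith
  · rintro _ ⟨k, hk, rfl⟩
    have h1 := hM (-k) hk
    rw [← hf]
    simp only [map_add, map_smul, hfe, smul_eq_mul, map_neg] at h1 ⊢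
    linarith
  · rintro _ ⟨k, hk, rfl⟩
    have h1 := hm (-k) hk
    rw [← hf]
    simp only [map_add, map_smul, hfe, smul_eq_mul, map_neg] at h1 ⊢
    linarith

end KlainVal

namespace KlainVal
set_option linter.unusedSectionVars false
variable {X : Type*} [NormedAddCommGroup X] [InnerProductSpace ℝ X] [FiniteDimensional ℝ X]

/-- support function -/
def supp (K : Set X) (x : X) : ℝ := sSup ((fun y => inner ℝ x y) '' K)

lemma supp_isGreatest {K : Set X} (hK : CC K) (hne : K.Nonempty) (x : X) :
    ∃ y ∈ K, inner ℝ x y = supp K x ∧ ∀ z ∈ K, inner ℝ x z ≤ supp K x := by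
  have hc : Continuous (fun y : X => inner ℝ x y) := by fun_prop
  obtain ⟨y, hy, hm⟩ := hK.2.exists_isMaxOn hne hc.continuousOn
  rw [isMaxOn_iff] at hm
  have : IsGreatest ((fun y => inner ℝ x y) '' K) (inner ℝ x y) :=
    ⟨⟨y, hy, rfl⟩, by rintro _ ⟨z, hz, rfl⟩; exact hm z hz⟩
  refine ⟨y, hy, this.csSup_eq.symm, ?_⟩
  intro z hz
  rw [supp, this.csSup_eq]; exact hm z hz

lemma supp_eq {K : Set X} {x : X} {a : ℝ} (h1 : ∃ y ∈ K, inner ℝ x y = a)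
    (h2 : ∀ z ∈ K, inner ℝ x z ≤ a) : supp K x = a := by
  obtain ⟨y, hy, rfl⟩ := h1
  have : IsGreatest ((fun y => inner ℝ x y) '' K) (inner ℝ x y) :=
    ⟨⟨y, hy, rfl⟩, by rintro _ ⟨z, hz, rfl⟩; exact h2 z hz⟩
  exact this.csSup_eq

lemma supp_add {K L : Set X} (hK : CC K) (hne : K.Nonempty) (hL : CC L) (hne' : L.Nonempty)
    (x : X) : supp (K + L) x = supp K x + supp L x := by
  obtain ⟨y, hy, h1, h2⟩ := supp_isGreatest hK hne x
  obtain ⟨y', hy', h1', h2'⟩ := supp_isGreatest hL hne' x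
  apply supp_eq
  · exact ⟨y + y', ⟨y, hy, y', hy', rfl⟩, by rw [inner_add_right, h1, h1']⟩
  · rintro _ ⟨z, hz, z', hz', rfl⟩
    simp only
    rw [inner_add_right]; exact add_le_add (h2 z hz) (h2' z' hz')

lemma supp_smul_set {K : Set X} (hK : CC K) (hne : K.Nonempty) {c : ℝ} (hc : 0 ≤ c) (x : X) :
    supp (c • K) x = c * supp K x := by
  obtain ⟨y, hy, h1, h2⟩ := supp_isGreatest hK hne x
  apply supp_eq
  · exact ⟨c • y, ⟨y, hy, rfl⟩, by rw [inner_smul_right, h1]⟩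
  · rintro _ ⟨z, hz, rfl⟩
    simp only
    rw [inner_smul_right]; exact mul_le_mul_of_nonneg_left (h2 z hz) hc

lemma supp_smul {K : Set X} (hK : CC K) (hne : K.Nonempty) {c : ℝ} (hc : 0 ≤ c) (x : X) :
    supp K (c • x) = c * supp K x := by
  obtain ⟨y, hy, h1, h2⟩ := supp_isGreatest hK hne x
  apply supp_eq
  · exact ⟨y, hy, by rw [inner_smul_left, h1]; simp⟩
  · rintro z hz
    rw [inner_smul_left]; simpa using mul_le_mul_of_nonneg_left (h2 z hz) hc

lemma supp_subadd {K : Set X} (hK : CC K) (hne : K.Nonempty) (x x' : X) :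
    supp K (x + x') ≤ supp K x + supp K x' := by
  obtain ⟨y, hy, h1, h2⟩ := supp_isGreatest hK hne (x + x')
  obtain ⟨_, _, _, h3⟩ := supp_isGreatest hK hne x
  obtain ⟨_, _, _, h4⟩ := supp_isGreatest hK hne x'
  rw [← h1, inner_add_left]
  exact add_le_add (h3 y hy) (h4 y hy)

lemma near_half {K L : Set X} (hK : CC K) (hL : CC L) (hLn : L.Nonempty) {δ : ℝ} (hδ : 0 ≤ δ)
    (h : ∀ x, supp K x ≤ supp L x + δ * ‖x‖) : ∀ y ∈ K, ∃ z ∈ L, dist y z ≤ δ := by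
  intro y hy
  obtain ⟨z, hz, hzm⟩ := exists_norm_eq_iInf_of_complete_convex hLn hL.2.isComplete hL.1 y
  have hin := (norm_eq_iInf_iff_real_inner_le_zero hL.1 hz).1 hzm
  refine ⟨z, hz, ?_⟩
  have h1 : supp L (y - z) = inner ℝ (y - z) z := by
    apply supp_eq ⟨z, hz, rfl⟩
    intro w hw
    have := hin w hw
    rw [inner_sub_right] at this
    linarith
  obtain ⟨_, _, _, h2⟩ := supp_isGreatest hK ⟨y, hy⟩ (y - z)
  have h3 := h2 y hy
  have h4 := h (y - z)
  rw [h1] at h4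
  have h5 : inner ℝ (y - z) y - inner ℝ (y - z) z = ‖y - z‖ ^ 2 := by
    rw [← inner_sub_right, real_inner_self_eq_norm_sq]
  rw [dist_eq_norm]
  by_contra hcon
  push Not at hcon
  nlinarith

lemma near_of_supp {K L : Set X} (hK : CC K) (hKn : K.Nonempty) (hL : CC L) (hLn : L.Nonempty)
    {δ : ℝ} (hδ : 0 ≤ δ) (h : ∀ x, |supp K x - supp L x| ≤ δ * ‖x‖) : Near δ K L := by
  refine ⟨near_half hK hL hLn hδ fun x => ?_, fun y hy => ?_⟩
  · have := (abs_le.1 (h x)).2; linarith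
  · obtain ⟨z, hz, h1⟩ := near_half hL hK hKn hδ
      (fun x => by have := (abs_le.1 (h x)).1; linarith) y hy
    exact ⟨z, hz, by rwa [dist_comm]⟩

lemma eq_of_supp {K L : Set X} (hK : CC K) (hKn : K.Nonempty) (hL : CC L) (hLn : L.Nonempty)
    (h : ∀ x, supp K x = supp L x) : K = L := by
  have hn : Near 0 K L := near_of_supp hK hKn hL hLn le_rfl (fun x => by simp [h])
  ext x
  constructor
  · intro hx
    obtain ⟨y, hy, hxy⟩ := hn.1 x hx
    rw [dist_le_zero] at hxy
    rwa [hxy]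
  · intro hx
    obtain ⟨y, hy, hxy⟩ := hn.2 x hx
    rw [dist_le_zero] at hxy
    rwa [← hxy]

/-- the body with a prescribed sublinear support function -/
lemma exists_body (N : X → ℝ) (hN1 : ∀ c : ℝ, 0 < c → ∀ x, N (c • x) = c * N x)
    (hN2 : ∀ x y, N (x + y) ≤ N x + N y) (C : ℝ) (hC0 : 0 ≤ C) (hC : ∀ x, N x ≤ C * ‖x‖) :
    ∃ K : Set X, CC K ∧ K.Nonempty ∧ ∀ x, supp K x = N x := by
  have hN0 : N 0 = 0 := by
    have := hN1 2 (by norm_num) 0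
    rw [smul_zero] at this
    linarith
  set K : Set X := {y | ∀ x, inner ℝ x y ≤ N x} with hKdef
  have hmax : ∀ x, ∃ y ∈ K, inner ℝ x y = N x := by
    intro x
    by_cases hx : x = 0
    · subst hx
      obtain ⟨g, -, hg⟩ := exists_extension_of_le_sublinear (⊥ : X →ₗ.[ℝ] ℝ) N hN1 hN2 (by
        rintro ⟨y, hy⟩
        have hy' : y = 0 := hy
        subst hy'
        have : (⟨0, hy⟩ : (⊥ : X →ₗ.[ℝ] ℝ).domain) = 0 := rfl
        rw [this, LinearPMap.map_zero]; simp [hN0])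
      refine ⟨(InnerProductSpace.toDual ℝ X).symm (LinearMap.toContinuousLinearMap g), ?_, ?_⟩
      · intro z
        rw [real_inner_comm, InnerProductSpace.toDual_symm_apply]; exact hg z
      · simp [hN0]
    · obtain ⟨g, hg1, hg⟩ := exists_extension_of_le_sublinear
        (LinearPMap.mkSpanSingleton (K := ℝ) x (N x) hx) N hN1 hN2 (by
        rintro ⟨y, hy⟩
        obtain ⟨c, rfl⟩ := Submodule.mem_span_singleton.1 hy
        rw [LinearPMap.mkSpanSingleton'_apply]
        simp only [smul_eq_mul, RingHom.id_apply]
        rcases lt_trichotomy c 0 with h | h | h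
        · have h1 := hN2 (c • x) ((-c) • x)
          rw [← add_smul] at h1
          simp only [add_neg_cancel, zero_smul, hN0] at h1
          rw [hN1 (-c) (by linarith)] at h1
          linarith
        · simp [h, hN0]
        · rw [hN1 c h])
      refine ⟨(InnerProductSpace.toDual ℝ X).symm (LinearMap.toContinuousLinearMap g), ?_, ?_⟩
      · intro z
        rw [real_inner_comm, InnerProductSpace.toDual_symm_apply]; exact hg z
      · rw [real_inner_comm, InnerProductSpace.toDual_symm_apply]
        have := hg1 ⟨x, Submodule.mem_span_singleton_self x⟩
        simp only [LinearMap.coe_toContinuousLinearMap']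
        rw [this]
        have h2 := LinearPMap.mkSpanSingleton_apply ℝ ℝ (σ := RingHom.id ℝ) hx (N x)
        simpa using h2
  refine ⟨K, ⟨?_, ?_⟩, ?_, ?_⟩
  · intro y hy z hz a b ha hb hab x
    rw [inner_add_right, inner_smul_right, inner_smul_right]
    have h1 := hy x
    have h2 := hz x
    have : N x = a * N x + b * N x := by rw [← add_mul, hab, one_mul]
    rw [this]
    gcongr
  · refine Metric.isCompact_of_isClosed_isBounded ?_ ?_
    · have : K = ⋂ x, {y | inner ℝ x y ≤ N x} := by ext; simp [hKdef]
      rw [this]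
      exact isClosed_iInter fun x => isClosed_le (by fun_prop) continuous_const
    · refine (Metric.isBounded_closedBall (x := (0:X)) (r := C)).subset ?_
      intro y hy
      rw [mem_closedBall_zero_iff]
      have h1 := (hy y).trans (hC y)
      rw [real_inner_self_eq_norm_sq] at h1
      by_contra hcon
      push Not at hcon
      have h2 := norm_nonneg y
      nlinarith
  · obtain ⟨y, hy, _⟩ := hmax 0
    exact ⟨y, hy⟩
  · intro x
    exact supp_eq (hmax x) (fun z hz => hz x)
end KlainVal

namespace KlainVal
set_option linter.unusedSectionVars false
variable {X : Type*} [NormedAddCommGroup X] [InnerProductSpace ℝ X] [FiniteDimensional ℝ X]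

/-- bodies whose Minkowski addition does not change `ν` -/
def Neg (ν : Set X → ℂ) (Z : Set X) : Prop :=
  CC Z ∧ Z.Nonempty ∧ ∀ c : ℝ, 0 ≤ c → ∀ K, CC K → ν (K + c • Z) = ν K

lemma CC.smul {K : Set X} (hK : CC K) (c : ℝ) : CC (c • K) := ⟨hK.1.smul c, hK.2.smul c⟩

lemma supp_zero {K : Set X} (hne : K.Nonempty) : supp K 0 = 0 := by
  obtain ⟨y, hy⟩ := hne
  exact supp_eq ⟨y, hy, by simp⟩ (by simp)

/-- normalised vector as a point of the ball -/
def nb (x : X) : closedBall (0 : X) 1 := ⟨‖x‖⁻¹ • x, by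
  rw [mem_closedBall_zero_iff, norm_smul, norm_inv, norm_norm]
  by_cases h : ‖x‖ = 0
  · simp [h]
  · rw [inv_mul_cancel₀ h]⟩

lemma supp_nb {K : Set X} (hK : CC K) (hne : K.Nonempty) (x : X) :
    supp K x = ‖x‖ * supp K (nb x : X) := by
  by_cases h : x = 0
  · subst h; simp [supp_zero hne]
  · have : supp K (nb x : X) = ‖x‖⁻¹ * supp K x := by
      exact supp_smul hK hne (by positivity) x
    rw [this, ← mul_assoc, mul_inv_cancel₀ (norm_ne_zero_iff.2 h), one_mul]

/-- cone of support functions of negligible bodies -/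
def ZC (ν : Set X → ℂ) : Set C(closedBall (0 : X) 1, ℝ) :=
  {φ | ∃ Z, Neg ν Z ∧ ∀ x, φ x = supp Z (x : X)}

lemma Neg.add {ν : Set X → ℂ} {Y Z : Set X} (hY : Neg ν Y) (hZ : Neg ν Z) : Neg ν (Y + Z) := by
  refine ⟨hY.1.add hZ.1, hY.2.1.add hZ.2.1, fun c hc K hK => ?_⟩
  rw [smul_add, ← add_assoc, hZ.2.2 c hc _ (hK.add (hY.1.smul c)), hY.2.2 c hc K hK]

lemma Neg.smul {ν : Set X → ℂ} {Z : Set X} (hZ : Neg ν Z) {a : ℝ} (ha : 0 ≤ a) :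
    Neg ν (a • Z) := by
  refine ⟨hZ.1.smul a, hZ.2.1.smul_set, fun c hc K hK => ?_⟩
  rw [smul_smul, hZ.2.2 _ (mul_nonneg hc ha) K hK]

lemma neg_zero_set {ν : Set X → ℂ} : Neg ν ({0} : Set X) := by
  refine ⟨⟨convex_singleton 0, isCompact_singleton⟩, singleton_nonempty 0, fun c hc K hK => ?_⟩
  simp

lemma ZC_zero {ν : Set X → ℂ} : (0 : C(closedBall (0 : X) 1, ℝ)) ∈ ZC ν :=
  ⟨{0}, neg_zero_set, fun x => by rw [supp_eq (a := 0) ⟨0, by simp, by simp⟩ (by simp)]; rfl⟩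

lemma ZC_add {ν : Set X → ℂ} {φ ψ : C(closedBall (0 : X) 1, ℝ)} (h : φ ∈ ZC ν) (h' : ψ ∈ ZC ν) :
    φ + ψ ∈ ZC ν := by
  obtain ⟨Y, hY, h1⟩ := h
  obtain ⟨Z, hZ, h2⟩ := h'
  exact ⟨Y + Z, hY.add hZ, fun x => by
    rw [supp_add hY.1 hY.2.1 hZ.1 hZ.2.1, ← h1, ← h2]; rfl⟩

lemma ZC_smul {ν : Set X → ℂ} {φ : C(closedBall (0 : X) 1, ℝ)} (h : φ ∈ ZC ν) {a : ℝ}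
    (ha : 0 ≤ a) : a • φ ∈ ZC ν := by
  obtain ⟨Y, hY, h1⟩ := h
  exact ⟨a • Y, hY.smul ha, fun x => by rw [supp_smul_set hY.1 hY.2.1 ha, ← h1]; rfl⟩

lemma ZC_convex {ν : Set X → ℂ} : Convex ℝ (ZC ν) := by
  intro φ hφ ψ hψ a b ha hb _
  exact ZC_add (ZC_smul hφ ha) (ZC_smul hψ hb)

instance : CompactSpace (closedBall (0 : X) 1) :=
  isCompact_iff_compactSpace.1 (isCompact_closedBall 0 1)

lemma Near.smul {K L : Set X} {δ : ℝ} (h : Near δ K L) {c : ℝ} (hc : 0 ≤ c) :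
    Near (c * δ) (c • K) (c • L) := by
  constructor
  · rintro _ ⟨x, hx, rfl⟩
    obtain ⟨y, hy, hd⟩ := h.1 x hx
    refine ⟨c • y, ⟨y, hy, rfl⟩, ?_⟩
    simp only
    rw [dist_smul₀, Real.norm_of_nonneg hc]
    gcongr
  · rintro _ ⟨x, hx, rfl⟩
    obtain ⟨y, hy, hd⟩ := h.2 x hx
    refine ⟨c • y, ⟨y, hy, rfl⟩, ?_⟩
    simp only
    rw [dist_smul₀, Real.norm_of_nonneg hc]
    gcongr

lemma ZC_closed {ν : Set X → ℂ} (hV : Val ν) : IsClosed (ZC ν) := by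
  apply isClosed_of_closure_subset
  intro φ hφ
  obtain ⟨ψ, hψ, hlim⟩ := mem_closure_iff_seq_limit.1 hφ
  choose Z hZ hZs using hψ
  have hpt : ∀ y, Filter.Tendsto (fun j => ψ j y) Filter.atTop (nhds (φ y)) := fun y =>
    ((ContinuousMap.evalCLM ℝ y).continuous.tendsto φ).comp hlim
  set N : X → ℝ := fun x => ‖x‖ * φ (nb x) with hN
  have hs : ∀ j x, supp (Z j) x = ‖x‖ * ψ j (nb x) := fun j x => by
    rw [hZs, ← supp_nb (hZ j).1 (hZ j).2.1]
  have hNl : ∀ x, Filter.Tendsto (fun j => supp (Z j) x) Filter.atTop (nhds (N x)) := by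
    intro x
    simp only [hs]
    exact (hpt (nb x)).const_mul _
  obtain ⟨K, hK, hKn, hKs⟩ := exists_body N
    (fun c hc x => by
      refine tendsto_nhds_unique (hNl (c • x)) ?_
      simp only [fun j => supp_smul (hZ j).1 (hZ j).2.1 hc.le x]
      exact (hNl x).const_mul c)
    (fun x y => le_of_tendsto_of_tendsto' (hNl (x + y)) ((hNl x).add (hNl y))
      fun j => supp_subadd (hZ j).1 (hZ j).2.1 x y) ‖φ‖ (norm_nonneg _)
    (fun x => by
      show ‖x‖ * φ (nb x) ≤ ‖φ‖ * ‖x‖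
      rw [mul_comm]
      exact mul_le_mul_of_nonneg_right ((le_abs_self _).trans (φ.norm_coe_le_norm _))
        (norm_nonneg x))
  have hnear : ∀ δ > 0, ∃ j, Near δ K (Z j) := by
    intro δ hδ
    obtain ⟨j, hj⟩ := ((Metric.tendsto_nhds.1 hlim) δ hδ).exists
    refine ⟨j, near_of_supp hK hKn (hZ j).1 (hZ j).2.1 hδ.le fun x => ?_⟩
    rw [hKs, hs, hN]
    simp only
    rw [← mul_sub, abs_mul, abs_norm, mul_comm]
    refine mul_le_mul_of_nonneg_right ?_ (norm_nonneg _)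
    rw [← Real.dist_eq, dist_comm]
    exact (ContinuousMap.dist_apply_le_dist _).trans hj.le
  refine ⟨K, ⟨hK, hKn, fun c hc M hM => ?_⟩, fun x => ?_⟩
  · rcases M.eq_empty_or_nonempty with rfl | hMn
    · simp
    refine hV.approx (hM.add (hK.smul c)) (hMn.add hKn.smul_set) hM hMn fun δ hδ => ?_
    obtain ⟨j, hj⟩ := hnear (δ / (c + 1)) (by positivity)
    refine ⟨M + c • Z j, M, hM.add ((hZ j).1.smul c), hMn.add (hZ j).2.1.smul_set, hM, hMn,
      ((Near.refl M).add (hj.smul hc)).mono ?_, (Near.refl M).mono hδ.le, (hZ j).2.2 c hc M hM⟩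
    rw [zero_add, mul_div_assoc', div_le_iff₀ (by positivity)]
    nlinarith
  · refine tendsto_nhds_unique (hpt x) ?_
    simp only [hZs]
    rw [hKs]; exact hNl _

/-- the support function of the segment `[-u,u]` -/
def segF (u : X) : C(closedBall (0 : X) 1, ℝ) := ⟨fun x => |inner ℝ u (x : X)|, by fun_prop⟩

lemma segF_cont : Continuous (segF (X := X)) := by
  refine ContinuousMap.continuous_of_continuous_uncurry _ ?_
  show Continuous (fun p : X × closedBall (0 : X) 1 => |inner ℝ p.1 (p.2 : X)|)
  fun_prop

lemma segF_norm (u : X) : ‖segF u‖ ≤ ‖u‖ := by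
  rw [ContinuousMap.norm_le _ (norm_nonneg _)]
  intro x
  have h1 : ‖(x : X)‖ ≤ 1 := mem_closedBall_zero_iff.1 x.2
  show ‖|inner ℝ u (x : X)|‖ ≤ ‖u‖
  rw [Real.norm_eq_abs, abs_abs]
  refine (abs_real_inner_le_norm u x).trans ?_
  have := norm_nonneg u
  nlinarith

lemma segF_mem {ν : Set X → ℂ} (hV : Val ν) (hA : ∀ v K, CC K → ν (K + seg v) = ν K) (u : X) :
    segF u ∈ ZC ν := by
  refine ⟨(fun y => -u + y) '' seg ((2:ℝ) • u), ⟨(cc_seg _).translate _, (seg_nonempty _).image _,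
    fun c hc K hK => ?_⟩, fun x => ?_⟩
  · have h1 : K + c • ((fun y => -u + y) '' seg ((2:ℝ) • u))
      = (fun y => -(c • u) + y) '' (K + seg ((2 * c) • u)) := by
      ext z
      constructor
      · rintro ⟨k, hk, _, ⟨_, ⟨_, ⟨t, ht, rfl⟩, rfl⟩, rfl⟩, rfl⟩
        refine ⟨k + t • (2 * c) • u, ⟨k, hk, _, ⟨t, ht, rfl⟩, rfl⟩, ?_⟩
        simp only; module
      · rintro ⟨_, ⟨k, hk, _, ⟨t, ht, rfl⟩, rfl⟩, rfl⟩
        refine ⟨k, hk, _, ⟨_, ⟨_, ⟨t, ht, rfl⟩, rfl⟩, rfl⟩, ?_⟩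
        simp only; module
    rw [h1, hV.trans _ (hK.add (cc_seg _)), hA _ _ hK]
  · symm
    show _ = |inner ℝ u (x : X)|
    apply supp_eq
    · rcases le_total 0 (inner ℝ u (x : X)) with h | h
      · refine ⟨_, ⟨_, ⟨1, by simp, rfl⟩, rfl⟩, ?_⟩
        rw [abs_of_nonneg h, real_inner_comm (x : X) u]
        congr 1
        module
      · refine ⟨_, ⟨_, ⟨0, by simp, rfl⟩, rfl⟩, ?_⟩
        rw [abs_of_nonpos h, real_inner_comm (x : X) u, ← inner_neg_right]
        congr 1
        module
    · rintro _ ⟨_, ⟨t, ht, rfl⟩, rfl⟩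
      simp only
      have : -u + t • (2:ℝ) • u = (2 * t - 1) • u := by module
      rw [this, inner_smul_right, real_inner_comm]
      have h2 : |2 * t - 1| ≤ 1 := by rw [abs_le]; constructor <;> linarith [ht.1, ht.2]
      calc (2 * t - 1) * inner ℝ u (x : X) ≤ |(2 * t - 1) * inner ℝ u (x : X)| := le_abs_self _
        _ = |2 * t - 1| * |inner ℝ u (x : X)| := abs_mul _ _
        _ ≤ 1 * |inner ℝ u (x : X)| := by gcongr
        _ = _ := one_mul _

variable [MeasurableSpace X] [BorelSpace X]

lemma int_body {ν : Set X → ℂ} (hV : Val ν) (hA : ∀ v K, CC K → ν (K + seg v) = ν K)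
    (r : X → ℝ) (hr : Continuous r) (h0 : ∀ u, 0 ≤ r u)
    (hi : Integrable (fun u => r u * ‖u‖)) :
    ∃ Z, Neg ν Z ∧ ∀ x, supp Z x = ∫ u, r u * |inner ℝ u x| := by
  have hintg : Integrable (fun u => r u • segF u) := by
    refine hi.mono' ?_ ?_
    · exact (hr.smul segF_cont).aestronglyMeasurable
    · refine Filter.Eventually.of_forall fun u => ?_
      rw [norm_smul, Real.norm_of_nonneg (h0 u)]
      exact mul_le_mul_of_nonneg_left (segF_norm u) (h0 u)
  have hmem : (∫ u, r u • segF u) ∈ ZC ν := by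
    by_contra hcon
    obtain ⟨l, c, h1, h2⟩ := geometric_hahn_banach_closed_point ZC_convex (ZC_closed hV) hcon
    have hc : 0 < c := by simpa using h1 0 ZC_zero
    have hneg : ∀ φ ∈ ZC ν, l φ ≤ 0 := by
      intro φ hφ
      by_contra hp
      push Not at hp
      have := h1 _ (ZC_smul hφ (a := c / l φ) (by positivity))
      rw [map_smul, smul_eq_mul, div_mul_cancel₀ _ hp.ne'] at this
      exact lt_irrefl _ this
    rw [← l.integral_comp_comm hintg] at h2
    have : ∫ u, l (r u • segF u) ≤ 0 := integral_nonpos fun u =>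
      hneg _ (ZC_smul (segF_mem hV hA u) (h0 u))
    linarith
  obtain ⟨Z, hZ, hs⟩ := hmem
  refine ⟨Z, hZ, fun x => ?_⟩
  rw [supp_nb hZ.1 hZ.2.1, ← hs]
  have := (ContinuousMap.evalCLM ℝ (nb x)).integral_comp_comm hintg
  have h3 : (∫ u, r u • segF u) (nb x) = ∫ u, r u * |inner ℝ u (nb x : X)| := this.symm
  rw [h3, ← integral_const_mul]
  congr 1
  ext u
  by_cases hx : x = 0
  · simp [hx]
  have : inner ℝ u (nb x : X) = ‖x‖⁻¹ * inner ℝ u x := by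
    show inner ℝ u (‖x‖⁻¹ • x) = _
    rw [inner_smul_right]
  rw [this, abs_mul, abs_inv, abs_norm]
  have := norm_ne_zero_iff.2 hx
  field_simp

/-- difference-of-zonoids principle -/
lemma zero_of_genzonoid {ν : Set X → ℂ} (hV : Val ν) (h00 : ν {0} = 0)
    (hA : ∀ v K, CC K → ν (K + seg v) = ν K)
    (r : X → ℝ) (hr : Continuous r) (hi : Integrable (fun u => r u * ‖u‖))
    {K : Set X} (hK : CC K) (hKn : K.Nonempty) (hs : ∀ x, supp K x = ∫ u, r u * |inner ℝ u x|) :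
    ν K = 0 := by
  have habs : Integrable (fun u => |r u| * ‖u‖) := by
    have := hi.abs
    simpa [abs_mul] using this
  have key : ∀ s : X → ℝ, Continuous s → (∀ u, |s u| ≤ |r u|) →
      Integrable (fun u => s u * ‖u‖) ∧ ∀ x, Integrable (fun u => s u * |inner ℝ u x|) := by
    intro s hsc hsr
    refine ⟨habs.mono' (by fun_prop) (.of_forall fun u => ?_), fun x =>
      (habs.mul_const ‖x‖).mono' (by fun_prop) (.of_forall fun u => ?_)⟩
    · rw [norm_mul, norm_norm, Real.norm_eq_abs]; exact mul_le_mul_of_nonneg_right (hsr u) (norm_nonneg u)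
    · rw [norm_mul, Real.norm_eq_abs, Real.norm_eq_abs, abs_abs, mul_assoc]
      exact mul_le_mul (hsr u) (abs_real_inner_le_norm u x) (abs_nonneg _) (abs_nonneg _)
  have kp := key (fun u => max (r u) 0) (by fun_prop) (fun u => by
    rw [abs_of_nonneg (le_max_right _ _)]; exact max_le (le_abs_self _) (abs_nonneg _))
  have km := key (fun u => max (-r u) 0) (by fun_prop) (fun u => by
    rw [abs_of_nonneg (le_max_right _ _)]; exact max_le (neg_le_abs _) (abs_nonneg _))
  obtain ⟨Z, hZ, hZs⟩ := int_body hV hA (fun u => max (r u) 0) (by fun_prop)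
    (fun u => le_max_right _ _) kp.1
  obtain ⟨Y, hY, hYs⟩ := int_body hV hA (fun u => max (-r u) 0) (by fun_prop)
    (fun u => le_max_right _ _) km.1
  have hKY : K + Y = Z := by
    refine eq_of_supp (hK.add hY.1) (hKn.add hY.2.1) hZ.1 hZ.2.1 fun x => ?_
    rw [supp_add hK hKn hY.1 hY.2.1, hs, hYs, hZs, ← integral_add ((key r hr fun _ => le_rfl).2 x)
      (km.2 x)]
    congr 1
    ext u
    rw [← add_mul]
    congr 1
    rcases le_total 0 (r u) with h | h
    · rw [max_eq_right (by linarith), max_eq_left h, add_zero]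
    · rw [max_eq_left (by linarith), max_eq_right h]; ring
  have h1 := hY.2.2 1 zero_le_one K hK
  have h2 := hZ.2.2 1 zero_le_one {0} (neg_zero_set (ν := ν)).1
  rw [one_smul] at h1 h2
  rw [← h1, hKY, ← h00, ← h2]
  congr 1
  simp
end KlainVal

namespace KlainVal
set_option linter.unusedSectionVars false
variable {X : Type*} [NormedAddCommGroup X] [InnerProductSpace ℝ X] [FiniteDimensional ℝ X]

lemma inv_sq_int {c : ℝ} (hc : 0 < c) : IntegrableOn (fun t : ℝ => 1 / t ^ 2) (Ioi c) := by
  have := integrableOn_Ioi_rpow_of_lt (a := -2) (by norm_num) hc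
  refine this.congr_fun (fun t ht => ?_) measurableSet_Ioi
  have ht' : 0 < t := hc.trans ht
  simp only
  rw [Real.rpow_neg ht'.le, one_div]
  norm_num

/-- the cosine kernel -/
def kc (t : ℝ) : ℝ := (1 - Real.cos (2 * Real.pi * t)) / t ^ 2

lemma kc_nonneg (t : ℝ) : 0 ≤ kc t :=
  div_nonneg (by linarith [Real.cos_le_one (2 * Real.pi * t)]) (sq_nonneg t)

lemma kc_meas : Measurable kc := by unfold kc; fun_prop

lemma kc_int : IntegrableOn kc (Ioi 0) := by
  rw [← Ioc_union_Ioi_eq_Ioi (zero_le_one' ℝ), integrableOn_union]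
  constructor
  · refine Integrable.mono' (g := fun _ => 2 * Real.pi ^ 2) (integrable_const _)
      kc_meas.aestronglyMeasurable ?_
    refine (ae_restrict_iff' measurableSet_Ioc).2 (.of_forall fun t ht => ?_)
    rw [Real.norm_of_nonneg (kc_nonneg t), kc, div_le_iff₀ (by have := ht.1; positivity)]
    have := Real.one_sub_sq_div_two_le_cos (x := 2 * Real.pi * t)
    linarith
  · refine Integrable.mono' ((inv_sq_int one_pos).const_mul 2) kc_meas.aestronglyMeasurable ?_
    refine (ae_restrict_iff' measurableSet_Ioi).2 (.of_forall fun t ht => ?_)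
    rw [Real.norm_of_nonneg (kc_nonneg t), kc, mul_one_div]
    gcongr
    linarith [Real.neg_one_le_cos (2 * Real.pi * t)]

/-- general scaling -/
lemma scale_int (k : ℝ → ℝ) (hk : IntegrableOn k (Ioi 0)) (s : ℝ) (hs : 0 < s) :
    IntegrableOn (fun t => s ^ 2 * k (s * t)) (Ioi 0) ∧
      ∫ t in Ioi 0, s ^ 2 * k (s * t) = (∫ t in Ioi 0, k t) * s := by
  constructor
  · refine Integrable.const_mul ?_ _
    have := (integrableOn_Ioi_comp_mul_left_iff k 0 hs).2 (by simpa using hk)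
    exact this
  · rw [integral_const_mul, integral_comp_mul_left_Ioi _ _ hs, mul_zero, smul_eq_mul]
    field_simp

lemma kc_scale (s : ℝ) :
    IntegrableOn (fun t => (1 - Real.cos (2 * Real.pi * (t * s))) / t ^ 2) (Ioi 0) ∧
      ∫ t in Ioi 0, (1 - Real.cos (2 * Real.pi * (t * s))) / t ^ 2 = (∫ t in Ioi 0, kc t) * |s| := by
  by_cases hs : s = 0
  · subst hs; simp
  have h := scale_int kc kc_int |s| (abs_pos.2 hs)
  have e : ∀ t ∈ Ioi (0:ℝ), |s| ^ 2 * kc (|s| * t)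
      = (1 - Real.cos (2 * Real.pi * (t * s))) / t ^ 2 := by
    intro t ht
    have ht' : t ≠ 0 := ne_of_gt ht
    have hc : Real.cos (2 * Real.pi * (|s| * t)) = Real.cos (2 * Real.pi * (t * s)) := by
      rcases abs_choice s with h | h
      · rw [h]; congr 1; ring
      · rw [h, ← Real.cos_neg]; congr 1; ring
    rw [kc, hc]
    have : |s| ≠ 0 := abs_ne_zero.2 hs
    field_simp
  exact ⟨h.1.congr_fun e measurableSet_Ioi, by rw [← h.2]; exact (setIntegral_congr_fun measurableSet_Ioi e).symm⟩

variable [MeasurableSpace X] [BorelSpace X]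

open SchwartzMap FourierTransform in
lemma fourier_cos (φ : X → ℝ) (hφ : ContDiff ℝ (↑(⊤ : ℕ∞)) φ) (hc : HasCompactSupport φ)
    (he : ∀ x, φ (-x) = φ x) :
    ∃ g : X → ℝ, Continuous g ∧ Integrable g ∧ Integrable (fun u => g u * ‖u‖) ∧
      ∀ x, φ x = ∫ u, g u * Real.cos (2 * Real.pi * inner ℝ u x) := by
  set f : X → ℂ := fun x => (φ x : ℂ) with hf
  have hf1 : ContDiff ℝ (↑(⊤ : ℕ∞)) f := Complex.ofRealCLM.contDiff.comp hφ
  have hf2 : HasCompactSupport f := hc.comp_left (g := fun y : ℝ => (y : ℂ)) (by simp)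
  set Φ : 𝓢(X, ℂ) := hf2.toSchwartzMap hf1 with hΦ
  have hΦa : ∀ x, Φ x = (φ x : ℂ) := fun x => rfl
  set ρ : 𝓢(X, ℂ) := 𝓕⁻ Φ with hρ
  have hρi : Integrable (fun u => ρ u) := ρ.integrable
  have hinv : ∀ x, (φ x : ℂ) = ∫ u, Complex.exp (↑(-2 * Real.pi * inner ℝ u x) * Complex.I) • ρ u := by
    intro x
    rw [← hΦa, ← Real.fourier_eq' (fun u => ρ u), ← SchwartzMap.fourier_coe, hρ]
    simp
  have hintg : ∀ x, Integrable (fun u =>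
      Complex.exp (↑(-2 * Real.pi * inner ℝ u x) * Complex.I) • ρ u) := by
    intro x
    refine hρi.norm.mono' ?_ (.of_forall fun u => ?_)
    · have : Continuous (fun u => Complex.exp (↑(-2 * Real.pi * inner ℝ u x) * Complex.I) • ρ u) := by
        have := ρ.continuous
        fun_prop
      exact this.aestronglyMeasurable
    · rw [norm_smul, Complex.norm_exp_ofReal_mul_I, one_mul]
  have hρc := ρ.continuous
  refine ⟨fun u => (ρ u).re, by fun_prop, hρi.re, ?_, fun x => ?_⟩
  · refine (ρ.integrable_pow_mul volume 1).mono' (by fun_prop) (.of_forall fun u => ?_)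
    rw [norm_mul, norm_norm, pow_one, mul_comm]
    gcongr
    exact Complex.abs_re_le_norm _
  · have h1 : (2 * φ x : ℂ) = ∫ u, (2 * Real.cos (2 * Real.pi * inner ℝ u x) : ℂ) * ρ u := by
      have : (2 * φ x : ℂ) = (φ x : ℂ) + (φ (-x) : ℂ) := by rw [he]; ring
      rw [this, hinv x, hinv (-x), ← integral_add (hintg x) (hintg (-x))]
      congr 1
      ext u
      rw [← add_smul, smul_eq_mul, inner_neg_right, Complex.ofReal_cos, Complex.two_cos]
      congr 1
      rw [add_comm]
      congr 2 <;> push_cast <;> ring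
    have h2 : Integrable (fun u => (2 * Real.cos (2 * Real.pi * inner ℝ u x) : ℂ) * ρ u) := by
      refine (hρi.norm.const_mul 2).mono' ?_ (.of_forall fun u => ?_)
      · have : Continuous (fun u => (2 * Real.cos (2 * Real.pi * inner ℝ u x) : ℂ) * ρ u) := by
          fun_prop
        exact this.aestronglyMeasurable
      · rw [norm_mul, norm_mul, Complex.norm_real, Complex.norm_two]
        have := Real.abs_cos_le_one (2 * Real.pi * inner ℝ u x)
        rw [Real.norm_eq_abs]
        gcongr
        linarith
    have h3 := congrArg Complex.re h1
    have h4 : ∫ u, ((2 * Real.cos (2 * Real.pi * inner ℝ u x) : ℂ) * ρ u).re = _ :=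
      Complex.reCLM.integral_comp_comm h2
    rw [Complex.reCLM_apply] at h4
    rw [← h4] at h3
    have h5 : ∀ u, ((2 * Real.cos (2 * Real.pi * inner ℝ u x) : ℂ) * ρ u).re
        = 2 * ((ρ u).re * Real.cos (2 * Real.pi * inner ℝ u x)) := by
      intro u
      rw [← Complex.ofReal_ofNat, ← Complex.ofReal_mul, Complex.re_ofReal_mul]
      ring
    simp only [h5] at h3
    rw [integral_const_mul, ← Complex.ofReal_ofNat, ← Complex.ofReal_mul, Complex.ofReal_re] at h3
    linarith
end KlainVal

namespace KlainVal
set_option linter.unusedSectionVars false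
variable {X : Type*} [NormedAddCommGroup X] [InnerProductSpace ℝ X] [FiniteDimensional ℝ X]
variable [MeasurableSpace X] [BorelSpace X]

lemma fubini_cos (g : X → ℝ) (hg : Continuous g) (hi : Integrable g)
    (hi' : Integrable (fun u => g u * ‖u‖)) (x : X) :
    ∫ t in Ioi (0:ℝ), ((∫ u, g u) - ∫ u, g u * Real.cos (2 * Real.pi * inner ℝ u (t • x))) / t ^ 2
      = ∫ u, g u * ((∫ t in Ioi 0, kc t) * |inner ℝ u x|) := by
  obtain ⟨c0, hc0⟩ : ∃ c0, c0 = ∫ t in Ioi 0, kc t := ⟨_, rfl⟩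
  rw [← hc0]
  have hc0n : 0 ≤ c0 := by rw [hc0]; exact integral_nonneg kc_nonneg
  have hks : ∀ s : ℝ, IntegrableOn (fun t => (1 - Real.cos (2 * Real.pi * (t * s))) / t ^ 2) (Ioi 0) ∧
      ∫ t in Ioi 0, (1 - Real.cos (2 * Real.pi * (t * s))) / t ^ 2 = c0 * |s| := by
    intro s; rw [hc0]; exact kc_scale s
  set H : ℝ → X → ℝ := fun t u =>
    g u * ((1 - Real.cos (2 * Real.pi * (t * inner ℝ u x))) / t ^ 2) with hH
  have e1 : ∀ t : ℝ, ((∫ u, g u) - ∫ u, g u * Real.cos (2 * Real.pi * inner ℝ u (t • x))) / t ^ 2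
      = ∫ u, H t u := by
    intro t
    have hi2 : Integrable (fun u => g u * Real.cos (2 * Real.pi * inner ℝ u (t • x))) := by
      refine hi.norm.mono' ?_ (.of_forall fun u => ?_)
      · have : Continuous (fun u => g u * Real.cos (2 * Real.pi * inner ℝ u (t • x))) := by
          fun_prop
        exact this.aestronglyMeasurable
      · rw [norm_mul]
        have := Real.abs_cos_le_one (2 * Real.pi * inner ℝ u (t • x))
        rw [← Real.norm_eq_abs] at this
        exact mul_le_of_le_one_right (norm_nonneg _) this
    rw [← integral_sub hi hi2, ← integral_div]
    congr 1
    ext u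
    rw [hH, inner_smul_right]
    ring
  simp only [e1]
  have e2 : ∀ u, ∫ t in Ioi (0:ℝ), H t u = g u * (c0 * |inner ℝ u x|) := by
    intro u
    rw [hH, integral_const_mul, (hks (inner ℝ u x)).2]
  rw [integral_integral_swap]
  · simp only [e2]
  have hmeas : Measurable (Function.uncurry H) := by
    have : Measurable g := hg.measurable
    unfold Function.uncurry
    simp only [hH]
    fun_prop
  rw [integrable_prod_iff' hmeas.aestronglyMeasurable]
  have hA : ∀ u, Integrable (fun t => Function.uncurry H (t, u)) (volume.restrict (Ioi 0)) := by
    intro u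
    exact Integrable.const_mul (hks (inner ℝ u x)).1 (g u)
  refine ⟨Filter.Eventually.of_forall hA, ?_⟩
  have e3 : ∀ u, ∫ t in Ioi (0:ℝ), ‖Function.uncurry H (t, u)‖ = |g u| * (c0 * |inner ℝ u x|) := by
    intro u
    rw [← (hks (inner ℝ u x)).2, ← integral_const_mul]
    congr 1
    ext t
    simp only [Function.uncurry, hH]
    rw [norm_mul, Real.norm_eq_abs, Real.norm_of_nonneg]
    exact div_nonneg (by linarith [Real.cos_le_one (2 * Real.pi * (t * inner ℝ u x))]) (sq_nonneg t)
  simp only [e3]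
  refine (hi'.norm.mul_const (c0 * ‖x‖)).mono' ?_ (.of_forall fun u => ?_)
  · have : Continuous (fun u => |g u| * (c0 * |inner ℝ u x|)) := by fun_prop
    exact this.aestronglyMeasurable
  · rw [Real.norm_of_nonneg (by positivity), norm_mul, norm_norm, Real.norm_eq_abs, mul_assoc]
    have := abs_real_inner_le_norm u x
    calc |g u| * (c0 * |inner ℝ u x|) ≤ |g u| * (c0 * (‖u‖ * ‖x‖)) := by gcongr
      _ = _ := by ring

/-- generating density of a smooth even norm -/
lemma exists_density (p : X → ℝ) (hp : ContDiff ℝ (↑(⊤ : ℕ∞)) p) (m : ℕ) (hm : 1 ≤ m)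
    (hh : ∀ (t : ℝ) x, p (t • x) = t ^ (2 * m) * p x) (a : ℝ) (ha : 0 < a)
    (hlow : ∀ x, a * ‖x‖ ^ (2 * m) ≤ p x) :
    ∃ r : X → ℝ, Continuous r ∧ Integrable (fun u => r u * ‖u‖) ∧
      ∀ x, (p x) ^ ((1:ℝ) / (2 * m)) = ∫ u, r u * |inner ℝ u x| := by
  have hm0 : (2 * m : ℕ) ≠ 0 := by omega
  have hp0 : ∀ x, 0 ≤ p x := fun x => le_trans (by positivity) (hlow x)
  let b : ContDiffBump (0 : ℝ) := ⟨1, 2, one_pos, by norm_num⟩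
  have hb1 : ∀ s, |s| ≤ 1 → b s = 1 := fun s hs =>
    b.one_of_mem_closedBall (by simpa [b] using hs)
  have hb2 : ∀ s, 2 ≤ |s| → b s = 0 := fun s hs =>
    b.zero_of_le_dist (by simpa [b] using hs)
  set φ : X → ℝ := fun x => b (p x) with hφ
  have hφc : ContDiff ℝ (↑(⊤ : ℕ∞)) φ := b.contDiff.comp hp
  have hφs : HasCompactSupport φ := by
    refine HasCompactSupport.intro (K := closedBall 0 (max 1 (2 / a))) (isCompact_closedBall _ _) ?_
    intro x hx
    rw [mem_closedBall_zero_iff, not_le, max_lt_iff] at hx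
    apply hb2
    rw [abs_of_nonneg (hp0 x)]
    refine le_trans ?_ (hlow x)
    have h1 : ‖x‖ ≤ ‖x‖ ^ (2 * m) := le_self_pow₀ hx.1.le hm0
    have h2 := hx.2
    rw [div_lt_iff₀ ha] at h2
    nlinarith
  have hpe : ∀ x, p (-x) = p x := fun x => by
    have := hh (-1) x
    rw [neg_one_smul] at this
    rw [this, pow_mul]; simp
  obtain ⟨g, hg, hgi, hgi', hrep⟩ := fourier_cos φ hφc hφs (fun x => by rw [hφ]; simp only [hpe])
  have hφ0 : ∫ u, g u = 1 := by
    have h1 := hrep 0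
    have : p 0 = 0 := by have := hh 0 0; simpa [hm0] using this
    simp only [hφ, this, inner_zero_right, mul_zero, Real.cos_zero, mul_one] at h1
    rw [← h1, hb1 0 (by simp)]
  set k1 : ℝ → ℝ := fun t => (1 - b (t ^ (2 * m))) / t ^ 2 with hk1
  have hk1n : ∀ t, 0 ≤ k1 t := fun t => div_nonneg (by linarith [b.le_one (x := t ^ (2 * m))])
    (sq_nonneg t)
  have hk1m : Measurable k1 := by
    have : Measurable b := b.continuous.measurable
    simp only [hk1]
    fun_prop
  have hk1i : IntegrableOn k1 (Ioi 0) := by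
    rw [← Ioc_union_Ioi_eq_Ioi (zero_le_one' ℝ), integrableOn_union]
    constructor
    · refine IntegrableOn.congr_fun (f := fun _ => (0:ℝ)) (by simp) (fun t ht => ?_)
        measurableSet_Ioc
      simp only [hk1]
      rw [hb1 _ (by rw [abs_of_nonneg (by have := ht.1; positivity)]; exact pow_le_one₀ ht.1.le ht.2)]
      simp
    · refine Integrable.mono' (inv_sq_int one_pos) hk1m.aestronglyMeasurable ?_
      refine (ae_restrict_iff' measurableSet_Ioi).2 (.of_forall fun t ht => ?_)
      rw [Real.norm_of_nonneg (hk1n t)]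
      simp only [hk1]
      gcongr
      linarith [b.nonneg (x := t ^ (2 * m))]
  set c1 := ∫ t in Ioi 0, k1 t with hc1
  have hc1p : 0 < c1 := by
    rw [hc1, setIntegral_pos_iff_support_of_nonneg_ae (.of_forall hk1n) hk1i]
    refine lt_of_lt_of_le ?_ (measure_mono (s := Ioi 2) ?_)
    · simp
    · intro t ht
      have ht' : (2:ℝ) < t := ht
      refine ⟨?_, by show (0:ℝ) < t; linarith⟩
      rw [Function.mem_support]
      simp only [hk1]
      have h1 : t ≤ t ^ (2 * m) := le_self_pow₀ (by linarith) hm0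
      rw [hb2 _ (by rw [abs_of_nonneg (by positivity)]; linarith)]
      have : t ≠ 0 := by linarith
      simp [this]
  set c0 := ∫ t in Ioi 0, kc t with hc0
  have hq : ∀ x, c1 * (p x) ^ ((1:ℝ) / (2 * m)) = ∫ u, g u * (c0 * |inner ℝ u x|) := by
    intro x
    by_cases hx : x = 0
    · have : p 0 = 0 := by have := hh 0 0; simpa [hm0] using this
      subst hx
      have hne : ((1:ℝ) / (2 * m)) ≠ 0 := by positivity
      rw [this, Real.zero_rpow hne]
      simp
    have hpx : 0 < p x := lt_of_lt_of_le (by have := norm_pos_iff.2 hx; positivity) (hlow x)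
    set q := (p x) ^ ((1:ℝ) / (2 * m)) with hqd
    have hq0 : 0 < q := Real.rpow_pos_of_pos hpx _
    have hqp : q ^ (2 * m) = p x := by
      rw [hqd, one_div, ← Nat.cast_ofNat, ← Nat.cast_mul]
      exact Real.rpow_inv_natCast_pow hpx.le hm0
    rw [← fubini_cos g hg hgi hgi' x, ← (scale_int k1 hk1i q hq0).2]
    refine setIntegral_congr_fun measurableSet_Ioi fun t ht => ?_
    have ht' : t ≠ 0 := ne_of_gt ht
    rw [← hrep, hφ0, hk1]
    simp only [hφ]
    rw [hh, mul_pow, hqp, mul_comm (p x)]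
    field_simp
  refine ⟨fun u => c0 / c1 * g u, by fun_prop, ?_, fun x => ?_⟩
  · simp only [mul_assoc]
    exact hgi'.const_mul _
  · have := hq x
    have e : ∀ u, c0 / c1 * g u * |inner ℝ u x| = c1⁻¹ * (g u * (c0 * |inner ℝ u x|)) := by
      intro u; ring
    simp only [e]
    rw [integral_const_mul, ← this, ← mul_assoc, inv_mul_cancel₀ hc1p.ne', one_mul]
end KlainVal

namespace KlainVal
set_option linter.unusedSectionVars false
variable {X : Type*} [NormedAddCommGroup X] [InnerProductSpace ℝ X] [FiniteDimensional ℝ X]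

lemma lp_subadd {ι : Type*} (s : Finset ι) (w : ι → X → ℝ) (h0 : ∀ i x, 0 ≤ w i x)
    (hw : ∀ i x y, w i (x + y) ≤ w i x + w i y) (k : ℕ) (hk : 1 ≤ k) (x y : X) :
    (∑ i ∈ s, w i (x + y) ^ k) ^ ((1:ℝ) / k) ≤
      (∑ i ∈ s, w i x ^ k) ^ ((1:ℝ) / k) + (∑ i ∈ s, w i y ^ k) ^ ((1:ℝ) / k) := by
  have h1 := Real.Lp_add_le_of_nonneg s (f := fun i => w i x) (g := fun i => w i y) (p := (k:ℝ))
    (by exact_mod_cast hk) (fun i _ => h0 i x) (fun i _ => h0 i y)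
  simp only [Real.rpow_natCast] at h1
  refine le_trans ?_ h1
  refine Real.rpow_le_rpow (Finset.sum_nonneg fun i _ => pow_nonneg (h0 i _) _) ?_ (by positivity)
  refine Finset.sum_le_sum fun i _ => pow_le_pow_left₀ (h0 i _) (hw i x y) _

set_option maxHeartbeats 1000000 in
lemma sym_approx {S : Set X} (hS : CC S) (hn : S.Nonempty) (hsym : -S = S) (δ : ℝ) (hδ : 0 < δ) :
    ∃ (p : X → ℝ) (m : ℕ) (a : ℝ) (K : Set X), ContDiff ℝ (↑(⊤ : ℕ∞)) p ∧ 1 ≤ m ∧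
      (∀ (t : ℝ) x, p (t • x) = t ^ (2 * m) * p x) ∧ 0 < a ∧ (∀ x, a * ‖x‖ ^ (2 * m) ≤ p x) ∧
      CC K ∧ K.Nonempty ∧ (∀ x, supp K x = (p x) ^ ((1:ℝ) / (2 * m))) ∧ Near δ S K := by
  set ε := δ / 3 with hε
  have hε0 : 0 < ε := by positivity
  obtain ⟨t0, ht0S, ht0f, hcov⟩ := hS.2.finite_cover_balls hε0
  obtain ⟨t, rfl⟩ := ht0f.exists_finset_coe
  obtain ⟨R, hR0, hR⟩ : ∃ R : ℝ, 0 < R ∧ ∀ y ∈ S, ‖y‖ ≤ R := by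
    obtain ⟨R, hR⟩ := hS.2.isBounded.exists_norm_le
    exact ⟨max R 1, by positivity, fun y hy => (hR y hy).trans (le_max_left _ _)⟩
  have hh0 : ∀ x, 0 ≤ supp S x := by
    intro x
    obtain ⟨y, hy, -, h2⟩ := supp_isGreatest hS hn x
    have h3 := h2 y hy
    have h4 := h2 (-y) (by rw [← hsym]; simpa using hy)
    rw [inner_neg_right] at h4
    linarith
  have hhR : ∀ x, supp S x ≤ R * ‖x‖ := by
    intro x
    obtain ⟨y, hy, h1, -⟩ := supp_isGreatest hS hn x
    rw [← h1, mul_comm]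
    exact (real_inner_le_norm x y).trans (by gcongr; exact hR y hy)
  have hab : ∀ a ∈ t, ∀ x, |inner ℝ a x| ≤ supp S x := by
    intro a ha x
    have haS : a ∈ S := ht0S ha
    obtain ⟨-, -, -, h2⟩ := supp_isGreatest hS hn x
    have h3 := h2 a haS
    have h4 := h2 (-a) (by rw [← hsym]; simpa using haS)
    rw [inner_neg_right] at h4
    rw [real_inner_comm, abs_le]
    constructor <;> linarith
  -- choose parameters
  set η := min 1 (ε / R) with hη
  have hη0 : 0 < η := by positivity
  obtain ⟨m0, hm0⟩ := exists_nat_gt (t.card / η)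
  obtain ⟨m, hm⟩ : ∃ m, m = m0 + 1 := ⟨_, rfl⟩
  have hm1 : 1 ≤ m := by omega
  have hpow : (t.card + 1 : ℝ) ≤ (1 + η) ^ (2 * m) := by
    have h1 := one_add_mul_le_pow (a := η) (by linarith) (2 * m)
    rw [div_lt_iff₀ hη0] at hm0
    refine le_trans ?_ h1
    have : (m0 : ℝ) ≤ ((2 * m : ℕ) : ℝ) := by exact_mod_cast (by omega)
    nlinarith
  have hk0 : 2 * m ≠ 0 := by omega
  set p : X → ℝ := fun x => ∑ a ∈ t, (inner ℝ a x) ^ (2 * m) + ε ^ (2 * m) * (‖x‖ ^ 2) ^ m with hp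
  have hsumn : ∀ x : X, 0 ≤ ∑ a ∈ t, (inner ℝ a x) ^ (2 * m) := fun x =>
    Finset.sum_nonneg fun a _ => by rw [pow_mul]; positivity
  have hlow : ∀ x, ε ^ (2 * m) * ‖x‖ ^ (2 * m) ≤ p x := by
    intro x
    rw [hp]; simp only
    rw [← pow_mul]
    linarith [hsumn x]
  have hp0 : ∀ x, 0 ≤ p x := fun x => le_trans (by positivity) (hlow x)
  have hhom : ∀ (c : ℝ) x, p (c • x) = c ^ (2 * m) * p x := by
    intro c x
    simp only [hp]
    rw [mul_add, Finset.mul_sum]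
    congr 1
    · refine Finset.sum_congr rfl fun a _ => ?_
      rw [inner_smul_right, mul_pow]
    · rw [norm_smul, mul_pow, mul_pow, Real.norm_eq_abs, sq_abs, ← pow_mul c]
      ring
  have hcd : ContDiff ℝ (↑(⊤ : ℕ∞)) p := by
    refine ContDiff.add (ContDiff.sum fun a _ => ?_) ?_
    · exact (contDiff_const.inner ℝ contDiff_id).pow _
    · exact contDiff_const.mul ((contDiff_norm_sq ℝ).pow _)
  have hcast : ((1:ℝ) / (2 * m)) = ((2 * m : ℕ) : ℝ)⁻¹ := by push_cast; rw [one_div]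
  set N : X → ℝ := fun x => (p x) ^ ((1:ℝ) / (2 * m)) with hN
  have hN0 : ∀ x, 0 ≤ N x := fun x => Real.rpow_nonneg (hp0 x) _
  have hNp : ∀ x, N x ^ (2 * m) = p x := by
    intro x
    simp only [hN]
    rw [hcast]
    exact Real.rpow_inv_natCast_pow (hp0 x) hk0
  have hle : ∀ x y, 0 ≤ y → p x ≤ y ^ (2 * m) → N x ≤ y := fun x y hy h =>
    le_of_pow_le_pow_left₀ hk0 hy (by rw [hNp]; exact h)
  have hge : ∀ x y, y ^ (2 * m) ≤ p x → y ≤ N x := fun x y h =>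
    le_of_pow_le_pow_left₀ hk0 (hN0 x) (by rw [hNp]; exact h)
  have hup : ∀ x, N x ≤ supp S x + 3 * ε * ‖x‖ := by
    intro x
    have h1 : N x ≤ (1 + η) * (supp S x + ε * ‖x‖) := by
      have hB : 0 ≤ supp S x + ε * ‖x‖ := add_nonneg (hh0 x) (by positivity)
      refine hle x _ (by positivity) ?_
      rw [mul_pow]
      refine le_trans ?_ (mul_le_mul_of_nonneg_right hpow (by positivity))
      rw [add_mul, one_mul]
      simp only [hp]
      refine add_le_add ?_ ?_
      · rw [← nsmul_eq_mul]
        refine Finset.sum_le_card_nsmul _ _ _ fun a ha => ?_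
        rw [← (even_two_mul m).pow_abs]
        refine pow_le_pow_left₀ (abs_nonneg _) ((hab a ha x).trans ?_) _
        have : 0 ≤ ε * ‖x‖ := by positivity
        linarith
      · rw [← pow_mul, ← mul_pow]
        exact pow_le_pow_left₀ (by positivity) (by linarith [hh0 x]) _
    have h2 : η * supp S x ≤ ε * ‖x‖ := by
      calc η * supp S x ≤ η * (R * ‖x‖) := by gcongr; exact hhR x
        _ ≤ (ε / R) * (R * ‖x‖) := by gcongr; exact min_le_right _ _
        _ = ε * ‖x‖ := by field_simp
    have h3 : η * (ε * ‖x‖) ≤ 1 * (ε * ‖x‖) := by gcongr; exact min_le_left _ _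
    nlinarith
  have hlo : ∀ x, supp S x - ε * ‖x‖ ≤ N x := by
    intro x
    obtain ⟨y, hy, h1, -⟩ := supp_isGreatest hS hn x
    have hyc := hcov hy
    simp only [mem_iUnion] at hyc
    obtain ⟨a, ha, hya⟩ := hyc
    have h2 : inner ℝ x y - inner ℝ x a ≤ ε * ‖x‖ := by
      rw [← inner_sub_right, mul_comm]
      refine (real_inner_le_norm _ _).trans ?_
      rw [mem_ball, dist_eq_norm] at hya
      gcongr
    have h3 : |inner ℝ a x| ≤ N x := by
      apply hge
      rw [(even_two_mul m).pow_abs]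
      simp only [hp]
      have h4 := Finset.single_le_sum (f := fun a => (inner ℝ a x : ℝ) ^ (2 * m))
        (fun b _ => by rw [pow_mul]; positivity) ha
      have : 0 ≤ ε ^ (2 * m) * (‖x‖ ^ 2) ^ m := by positivity
      linarith
    have h5 := le_abs_self (inner ℝ a x : ℝ)
    have h6 : (inner ℝ x a : ℝ) = inner ℝ a x := real_inner_comm _ _
    linarith
  have hsub : ∀ x y, N (x + y) ≤ N x + N y := by
    obtain ⟨w, hw⟩ : ∃ w : Option X → X → ℝ, w = fun (o : Option X) (x : X) =>
      o.elim (ε * ‖x‖) (fun a => |inner ℝ a x|) := ⟨_, rfl⟩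
    have hpw : ∀ x, N x = (∑ o ∈ Finset.insertNone t, w o x ^ (2 * m))
          ^ ((1:ℝ) / (2 * m : ℕ)) := by
      intro x
      simp only [hN, hp, hw]
      rw [Finset.sum_insertNone]
      push_cast
      congr 1
      simp only [Option.elim]
      rw [add_comm]
      congr 1
      · rw [mul_pow, ← pow_mul]
      · refine Finset.sum_congr rfl fun a _ => ?_
        rw [(even_two_mul m).pow_abs]
    intro x y
    rw [hpw, hpw x, hpw y]
    refine lp_subadd (Finset.insertNone t) w ?_ ?_ (2 * m) (by omega) x y <;> rw [hw]
    · rintro (_ | a) x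
      · simp only [Option.elim]; positivity
      · simp only [Option.elim]; positivity
    · rintro (_ | a) x y
      · simp only [Option.elim]
        rw [← mul_add]
        gcongr
        exact norm_add_le x y
      · simp only [Option.elim]
        rw [inner_add_right]
        exact abs_add_le _ _
  obtain ⟨K, hK, hKn, hKs⟩ := exists_body N
    (fun c hc x => by
      simp only [hN]
      rw [hhom, Real.mul_rpow (by positivity) (hp0 x)]
      congr 1
      rw [hcast]
      exact Real.pow_rpow_inv_natCast hc.le hk0) hsub (R + 3 * ε) (by positivity)
    (fun x => by
      have h1 := hup x
      have h2 := hhR x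
      linarith)
  refine ⟨p, m, ε ^ (2 * m), K, hcd, hm1, hhom, by positivity, hlow, hK, hKn, hKs, ?_⟩
  refine near_of_supp hS hn hK hKn hδ.le fun x => ?_
  rw [hKs, abs_le]
  have h1 := hup x
  have h2 := hlo x
  have h3 : 0 ≤ ε * ‖x‖ := by positivity
  have h4 : δ = 3 * ε := by rw [hε]; ring
  rw [h4]
  constructor <;> nlinarith

lemma zero_sym {ν : Set X → ℂ} (hV : Val ν) (h00 : ν {0} = 0)
    (hA : ∀ v K, CC K → ν (K + seg v) = ν K) {S : Set X} (hS : CC S) (hsym : -S = S) :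
    ν S = 0 := by
  rcases S.eq_empty_or_nonempty with rfl | hn
  · exact hV.empty
  borelize X
  have h0 : CC ({0} : Set X) := ⟨convex_singleton 0, isCompact_singleton⟩
  rw [← h00]
  refine hV.approx hS hn h0 (singleton_nonempty 0) fun δ hδ => ?_
  obtain ⟨p, m, a, K, hp, hm, hh, ha, hlow, hK, hKn, hKs, hnear⟩ := sym_approx hS hn hsym δ hδ
  obtain ⟨r, hr, hi, hrep⟩ := exists_density p hp m hm hh a ha hlow
  refine ⟨K, {0}, hK, hKn, h0, singleton_nonempty 0, hnear, (Near.refl _).mono hδ.le, ?_⟩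
  rw [h00]
  exact zero_of_genzonoid hV h00 hA r hr hi hK hKn fun x => by rw [hKs, hrep]
end KlainVal

namespace KlainVal
set_option linter.unusedSectionVars false
variable {X : Type*} [NormedAddCommGroup X] [InnerProductSpace ℝ X] [FiniteDimensional ℝ X]
variable {Y : Type*} [NormedAddCommGroup Y] [InnerProductSpace ℝ Y] [FiniteDimensional ℝ Y]

lemma CC.image {S : Set Y} (hS : CC S) (φ : Y →ₗ[ℝ] X) : CC (φ '' S) :=
  ⟨hS.1.linear_image φ, hS.2.image φ.continuous_of_finiteDimensional⟩

lemma near_image (φ : Y →ₗ[ℝ] X) : ∃ C > 0, ∀ (δ : ℝ) (S T : Set Y), Near δ S T →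
    Near (C * δ) (φ '' S) (φ '' T) := by
  set A := LinearMap.toContinuousLinearMap φ
  refine ⟨‖A‖ + 1, by positivity, fun δ S T h => ?_⟩
  have hd : ∀ x y, dist x y ≤ δ → dist (φ x) (φ y) ≤ (‖A‖ + 1) * δ := by
    intro x y hxy
    rw [dist_eq_norm, ← map_sub]
    have h1 : ‖A (x - y)‖ ≤ ‖A‖ * ‖x - y‖ := A.le_opNorm _
    rw [dist_eq_norm] at hxy
    have h2 := norm_nonneg A
    have h3 := norm_nonneg (x - y)
    have h4 : ‖φ (x - y)‖ ≤ ‖A‖ * ‖x - y‖ := h1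
    nlinarith
  constructor
  · rintro _ ⟨x, hx, rfl⟩
    obtain ⟨y, hy, hxy⟩ := h.1 x hx
    exact ⟨φ y, ⟨y, hy, rfl⟩, hd _ _ hxy⟩
  · rintro _ ⟨x, hx, rfl⟩
    obtain ⟨y, hy, hxy⟩ := h.2 x hx
    exact ⟨φ y, ⟨y, hy, rfl⟩, hd _ _ hxy⟩

lemma image_cut (φ : Y →ₗ[ℝ] X) (f : Y →ₗ[ℝ] ℝ) (g : X →ₗ[ℝ] ℝ) (hg : ∀ y, g (φ y) = f y)
    (S : Set Y) (T : Set ℝ) : φ '' (S ∩ {x | f x ∈ T}) = (φ '' S) ∩ {x | g x ∈ T} := by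
  ext z
  constructor
  · rintro ⟨x, ⟨hx, hf⟩, rfl⟩
    exact ⟨⟨x, hx, rfl⟩, by show g (φ x) ∈ T; rw [hg]; exact hf⟩
  · rintro ⟨⟨x, hx, rfl⟩, hf⟩
    exact ⟨x, ⟨hx, by have : g (φ x) ∈ T := hf; rwa [hg] at this⟩, rfl⟩

lemma para_cons {m : ℕ} (φ : Y →ₗ[ℝ] X) (v : X) (w : Fin m → Y) :
    φ '' (parallelepiped w) + seg v = parallelepiped (Fin.cons v (fun i => φ (w i)) : Fin (m+1) → X) := by
  ext z
  simp only [parallelepiped]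
  constructor
  · rintro ⟨_, ⟨_, ⟨t, ht, rfl⟩, rfl⟩, _, ⟨s, hs, rfl⟩, rfl⟩
    refine ⟨Fin.cons s t, ⟨?_, ?_⟩, ?_⟩
    · intro i; refine Fin.cases ?_ (fun j => ?_) i
      · simpa using hs.1
      · simpa using ht.1 j
    · intro i; refine Fin.cases ?_ (fun j => ?_) i
      · simpa using hs.2
      · simpa using ht.2 j
    · simp [Fin.sum_univ_succ, add_comm]
  · rintro ⟨t, ht, rfl⟩
    refine ⟨_, ⟨_, ⟨fun i => t i.succ, ⟨fun i => ht.1 _, fun i => ht.2 _⟩, rfl⟩, rfl⟩, _,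
      ⟨t 0, ⟨ht.1 0, ht.2 0⟩, rfl⟩, ?_⟩
    simp [Fin.sum_univ_succ, add_comm]

/-- the prism functional -/
lemma prism_val {ν : Set X → ℂ} (hV : Val ν) (hS : Simple ν) (φ : Y →ₗ[ℝ] X) (v : X)
    (hext : ∀ f : Y →ₗ[ℝ] ℝ, ∃ g : X →ₗ[ℝ] ℝ, (∀ y, g (φ y) = f y) ∧ g v = 0) :
    Val (fun S : Set Y => ν (φ '' S + seg v)) ∧ Simple (fun S : Set Y => ν (φ '' S + seg v)) := by
  refine ⟨⟨?_, ?_, ?_, ?_, ?_⟩, ?_⟩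
  · simp [hV.empty]
  · intro K hK f c
    obtain ⟨g, hg, hgv⟩ := hext f
    have key : ∀ T : Set ℝ, φ '' (K ∩ {x | f x ∈ T}) + seg v
        = (φ '' K + seg v) ∩ {x | g x ∈ T} := by
      intro T
      rw [image_cut φ f g hg, seg_cut _ _ _ hgv]
    have h1 := key {c}
    have h2 := key (Iic c)
    have h3 := key (Ici c)
    have := hV.cut _ ((hK.image φ).add (cc_seg v)) g c
    simp only [mem_singleton_iff, mem_Iic, mem_Ici] at h1 h2 h3
    rw [h1, h2, h3]
    exact this
  · intro K hK x
    rw [← hV.trans _ ((hK.image φ).add (cc_seg v)) (φ x)]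
    congr 1
    ext z
    constructor
    · rintro ⟨_, ⟨_, ⟨k, hk, rfl⟩, rfl⟩, s, hs, rfl⟩
      exact ⟨φ k + s, ⟨_, ⟨k, hk, rfl⟩, s, hs, rfl⟩, by simp [add_assoc]⟩
    · rintro ⟨_, ⟨_, ⟨k, hk, rfl⟩, s, hs, rfl⟩, rfl⟩
      exact ⟨_, ⟨_, ⟨k, hk, rfl⟩, rfl⟩, s, hs, by simp [add_assoc]⟩
  · intro K hK
    have hcc := (hK.image φ).add (cc_seg v)
    rw [← hV.even _ hcc, ← hV.trans _ hcc.neg v]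
    congr 1
    ext z
    constructor
    · rintro ⟨_, ⟨k, hk, rfl⟩, _, ⟨t, ht, rfl⟩, rfl⟩
      refine ⟨φ k + (t - 1) • v, ?_, ?_⟩
      · rw [mem_neg]
        refine ⟨φ (-k), ⟨-k, hk, rfl⟩, (1 - t) • v, ⟨1 - t, ⟨by linarith [ht.2], by linarith [ht.1]⟩, rfl⟩, ?_⟩
        simp only [map_neg]; module
      · simp only; module
    · rintro ⟨y, hy, rfl⟩
      rw [mem_neg] at hy
      obtain ⟨_, ⟨k, hk, rfl⟩, _, ⟨t, ht, rfl⟩, h⟩ := hy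
      have hy' : y = -(φ k + t • v) := by rw [← neg_neg y, ← h]
      refine ⟨φ (-k), ⟨-k, by simpa using hk, rfl⟩, (1 - t) • v,
        ⟨1 - t, ⟨by linarith [ht.2], by linarith [ht.1]⟩, rfl⟩, ?_⟩
      simp only [map_neg, hy']; module
  · intro K hK hne ε hε
    obtain ⟨δ, hδ, h⟩ := hV.cont _ ((hK.image φ).add (cc_seg v))
      ((hne.image φ).add (seg_nonempty v)) ε hε
    obtain ⟨C, hC, hCn⟩ := near_image φ
    refine ⟨δ / C, by positivity, fun L hL hLn hnear => ?_⟩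
    refine h _ ((hL.image φ).add (cc_seg v)) ((hLn.image φ).add (seg_nonempty v)) ?_
    refine ((hCn _ _ _ hnear).add (Near.refl _)).mono ?_
    rw [add_zero, mul_div_cancel₀ _ hC.ne']
  · intro K hK f c hf hKf
    obtain ⟨g, hg, hgv⟩ := hext f
    refine hS _ ((hK.image φ).add (cc_seg v)) g c ?_ ?_
    · rintro rfl
      apply hf
      ext y
      rw [← hg]; simp
    · rintro _ ⟨_, ⟨k, hk, rfl⟩, _, ⟨t, ht, rfl⟩, rfl⟩
      simp [hg, hgv, hKf k hk]

/-- Simple even valuations vanishing on parallelepipeds vanish. -/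
theorem klain (m : ℕ) : ∀ ν : Set (EuclideanSpace ℝ (Fin m)) → ℂ, Val ν → Simple ν →
    (∀ w : Fin m → EuclideanSpace ℝ (Fin m), ν (parallelepiped w) = 0) → ∀ K, CC K → ν K = 0 := by
  induction m with
  | zero =>
    intro ν hV hS hw K hK
    rcases K.eq_empty_or_nonempty with rfl | hne
    · exact hV.empty
    · rw [← hw (fun _ => 0)]
      congr 1
      have h1 : (parallelepiped (fun _ : Fin 0 => (0 : EuclideanSpace ℝ (Fin 0)))).Nonempty :=
        ⟨_, 0, by simp, rfl⟩
      rw [Subsingleton.eq_univ_of_nonempty hne, Subsingleton.eq_univ_of_nonempty h1]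
  | succ m ih =>
    intro ν hV hS hw K hK
    have hP : Prism ν := by
      intro f v c K hfv hK hKc
      rcases K.eq_empty_or_nonempty with rfl | ⟨x0, hx0⟩
      · simp [hV.empty]
      have hf0 : f ≠ 0 := by rintro rfl; simp at hfv
      have hdim : Module.finrank ℝ (EuclideanSpace ℝ (Fin m)) = Module.finrank ℝ (LinearMap.ker f) := by
        have := Module.Dual.finrank_ker_add_one_of_ne_zero (f := f) hf0
        simp only [finrank_euclideanSpace, Fintype.card_fin] at this ⊢
        omega
      set e := LinearEquiv.ofFinrankEq _ _ hdim
      set φ : EuclideanSpace ℝ (Fin m) →ₗ[ℝ] EuclideanSpace ℝ (Fin (m+1)) :=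
        (LinearMap.ker f).subtype ∘ₗ e.toLinearMap with hφ
      have hfφ : ∀ y, f (φ y) = 0 := fun y => (e y).2
      have hinj : ∀ y, φ y = 0 → y = 0 := by
        intro y hy
        have : e y = 0 := Subtype.ext hy
        simpa using this
      obtain ⟨ψ, hψ⟩ := LinearMap.exists_leftInverse_of_injective
        (φ.coprod (LinearMap.toSpanSingleton ℝ _ v)) (by
          rw [LinearMap.ker_eq_bot']
          rintro ⟨y, t⟩ h
          simp only [LinearMap.coprod_apply, LinearMap.toSpanSingleton_apply] at h
          have h1 := congrArg f h
          rw [map_add, hfφ, map_smul, smul_eq_mul, map_zero, zero_add] at h1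
          have ht : t = 0 := by simpa [hfv] using h1
          subst ht
          rw [zero_smul, add_zero] at h
          rw [hinj y h]; rfl)
      have hψ' : ∀ y t, ψ (φ y + t • v) = (y, t) := fun y t => by
        have := LinearMap.congr_fun hψ (y, t)
        simpa using this
      obtain ⟨h1, h2⟩ := prism_val hV hS φ v (fun f' =>
        ⟨f' ∘ₗ LinearMap.fst ℝ _ _ ∘ₗ ψ, fun y => by
          have := hψ' y 0
          rw [zero_smul, add_zero] at this
          simp [this], by
          have := hψ' 0 1
          rw [one_smul, map_zero, zero_add] at this
          simp [this]⟩)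
      have h3 := ih _ h1 h2 (fun w => by
        rw [para_cons]
        exact hw _)
      set K' := (fun y => -x0 + y) '' K with hK'
      have hK'cc : CC K' := hK.translate _
      have hφK : φ '' ((LinearMap.fst ℝ _ _ ∘ₗ ψ) '' K') = K' := by
        rw [image_image]
        refine (image_congr (g := id) ?_).trans (image_id _)
        rintro _ ⟨y, hy, rfl⟩
        have hk : -x0 + y ∈ LinearMap.ker f := by
          rw [LinearMap.mem_ker, map_add, map_neg, hKc _ hx0, hKc _ hy]; simp
        obtain ⟨z, hz⟩ := e.surjective ⟨_, hk⟩
        have hz' : φ z = -x0 + y := congrArg Subtype.val hz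
        have := hψ' z 0
        rw [zero_smul, add_zero] at this
        simp only [← hz']
        simp [this]
      have h4 := h3 ((LinearMap.fst ℝ _ _ ∘ₗ ψ) '' K') ⟨hK'cc.1.linear_image _,
        hK'cc.2.image (LinearMap.continuous_of_finiteDimensional _)⟩
      simp only at h4
      rw [hφK] at h4
      rw [← h4, ← hV.trans _ (hK.add (cc_seg v)) (-x0)]
      congr 1
      rw [hK']
      ext z
      constructor
      · rintro ⟨_, ⟨k, hk, s, hs, rfl⟩, rfl⟩
        exact ⟨_, ⟨k, hk, rfl⟩, s, hs, by simp [add_assoc]⟩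
      · rintro ⟨_, ⟨k, hk, rfl⟩, s, hs, rfl⟩
        exact ⟨_, ⟨k, hk, s, hs, rfl⟩, by simp [add_assoc]⟩
    have hA : ∀ v K, CC K → ν (K + seg v) = ν K := fun v K hK => add_seg hV hS hP v hK
    have hnt : Nontrivial (EuclideanSpace ℝ (Fin (m+1))) := inferInstance
    have h00 : ν {0} = 0 := by
      refine hS _ ⟨convex_singleton 0, isCompact_singleton⟩
        (EuclideanSpace.proj 0 : EuclideanSpace ℝ (Fin (m+1)) →L[ℝ] ℝ).toLinearMap 0 ?_ (by simp)
      intro h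
      have := LinearMap.congr_fun h (EuclideanSpace.single 0 1)
      simp at this
    exact zero_of_sym hV hS hA (fun S hS' hsym => zero_sym hV h00 hA hS' hsym) hK
end KlainVal

namespace KlainVal
set_option linter.unusedSectionVars false
variable {X : Type*} [NormedAddCommGroup X] [InnerProductSpace ℝ X] [FiniteDimensional ℝ X]
variable {m : ℕ}

/-- coordinate box -/
def Box (b : Module.Basis (Fin m) ℝ X) (a : Fin m → ℝ) : Set X :=
  {x | ∀ l, 0 ≤ b.coord l x ∧ b.coord l x ≤ a l}

lemma coord_self (b : Module.Basis (Fin m) ℝ X) (i : Fin m) : b.coord i (b i) = 1 := by simp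

lemma coord_ne (b : Module.Basis (Fin m) ℝ X) {i l : Fin m} (h : l ≠ i) : b.coord l (b i) = 0 := by
  simp [Finsupp.single_apply, h.symm]

lemma coord_ne_zero (b : Module.Basis (Fin m) ℝ X) (i : Fin m) : b.coord i ≠ 0 := by
  intro h
  have := coord_self b i
  rw [h] at this
  simp at this

lemma coord_sum (b : Module.Basis (Fin m) ℝ X) (t : Fin m → ℝ) (l : Fin m) :
    b.coord l (∑ i, t i • b i) = t l := by
  rw [map_sum]
  simp [Finsupp.single_apply]

lemma sum_coord (b : Module.Basis (Fin m) ℝ X) (x : X) : ∑ i, b.coord i x • b i = x := b.sum_repr x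

lemma para_eq_box (b : Module.Basis (Fin m) ℝ X) : parallelepiped b = Box b 1 := by
  ext x
  constructor
  · rintro ⟨t, ht, rfl⟩ l
    rw [coord_sum]
    exact ⟨ht.1 l, ht.2 l⟩
  · intro h
    exact ⟨fun i => b.coord i x, ⟨fun i => (h i).1, fun i => (h i).2⟩, sum_coord b x⟩

lemma cc_box (b : Module.Basis (Fin m) ℝ X) (a : Fin m → ℝ) : CC (Box b a) := by
  have : Box b a = (b.equivFun.symm : (Fin m → ℝ) →ₗ[ℝ] X) '' Icc 0 a := by
    ext x
    constructor
    · intro h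
      refine ⟨fun i => b.coord i x, ⟨fun i => (h i).1, fun i => (h i).2⟩, ?_⟩
      rw [LinearEquiv.coe_coe, b.equivFun_symm_apply]
      exact sum_coord b x
    · rintro ⟨t, ht, rfl⟩ l
      rw [LinearEquiv.coe_coe, b.equivFun_symm_apply, coord_sum]
      exact ⟨ht.1 l, ht.2 l⟩
  rw [this]
  exact ⟨(convex_Icc _ _).linear_image _,
    isCompact_Icc.image (LinearMap.continuous_of_finiteDimensional _)⟩

lemma mem_box_update (b : Module.Basis (Fin m) ℝ X) (a : Fin m → ℝ) (i : Fin m) (s : ℝ) (x : X) :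
    x ∈ Box b (Function.update a i s) ↔ (0 ≤ b.coord i x ∧ b.coord i x ≤ s) ∧
      ∀ l, l ≠ i → 0 ≤ b.coord l x ∧ b.coord l x ≤ a l := by
  constructor
  · intro h
    refine ⟨by simpa using h i, fun l hl => ?_⟩
    have := h l
    rwa [Function.update_of_ne hl] at this
  · rintro ⟨h1, h2⟩ l
    by_cases hl : l = i
    · subst hl; simpa using h1
    · rw [Function.update_of_ne hl]; exact h2 l hl

lemma box_add {ν : Set X → ℂ} (hV : Val ν) (hS : Simple ν) (b : Module.Basis (Fin m) ℝ X)
    (a : Fin m → ℝ) (i : Fin m) (s t : ℝ) (hs : 0 ≤ s) (ht : 0 ≤ t) :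
    ν (Box b (Function.update a i (s + t))) =
      ν (Box b (Function.update a i s)) + ν (Box b (Function.update a i t)) := by
  rw [simple_cut hV hS (cc_box b _) (b.coord i) (coord_ne_zero b i) s]
  congr 1
  · congr 1
    ext x
    rw [mem_inter_iff, mem_box_update, mem_box_update, mem_ofPred_eq]
    constructor
    · rintro ⟨⟨⟨h1, h2⟩, h3⟩, h4⟩; exact ⟨⟨h1, h4⟩, h3⟩
    · rintro ⟨⟨h1, h2⟩, h3⟩; exact ⟨⟨⟨h1, by linarith⟩, h3⟩, h2⟩
  · rw [← hV.trans _ (cc_box b (Function.update a i t)) (s • b i)]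
    congr 1
    ext x
    rw [mem_inter_iff, mem_box_update, mem_ofPred_eq]
    constructor
    · rintro ⟨⟨⟨h1, h2⟩, h3⟩, h4⟩
      refine ⟨-(s • b i) + x, ?_, by simp⟩
      rw [mem_box_update]
      refine ⟨?_, fun l hl => ?_⟩
      · rw [map_add, map_neg, map_smul, coord_self, smul_eq_mul]
        constructor <;> linarith
      · rw [map_add, map_neg, map_smul, coord_ne b hl]
        simpa using h3 l hl
    · rintro ⟨y, hy, rfl⟩
      rw [mem_box_update] at hy
      simp only
      rw [map_add, map_smul, coord_self, smul_eq_mul]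
      refine ⟨⟨⟨by linarith [hy.1.1], by linarith [hy.1.2]⟩, fun l hl => ?_⟩, by linarith [hy.1.1]⟩
      rw [map_add, map_smul, coord_ne b hl]
      simpa using hy.2 l hl

lemma box_near_half (b : Module.Basis (Fin m) ℝ X) (a : Fin m → ℝ) (i : Fin m)
    (s t : ℝ) (ht : 0 ≤ t) :
    ∀ x ∈ Box b (Function.update a i s), ∃ y ∈ Box b (Function.update a i t),
      dist x y ≤ |s - t| * ‖b i‖ := by
  intro x hx
  rw [mem_box_update] at hx
  refine ⟨x + (min (b.coord i x) t - b.coord i x) • b i, ?_, ?_⟩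
  · rw [mem_box_update]
    refine ⟨?_, fun l hl => ?_⟩
    · rw [map_add, map_smul, coord_self, smul_eq_mul, mul_one, add_sub_cancel]
      exact ⟨le_min hx.1.1 ht, min_le_right _ _⟩
    · rw [map_add, map_smul, coord_ne b hl]
      simpa using hx.2 l hl
  · rw [dist_self_add_right, norm_smul]
    gcongr
    rw [Real.norm_eq_abs]
    rcases le_total (b.coord i x) t with h | h
    · rw [min_eq_left h]; simp
    · rw [min_eq_right h, abs_of_nonpos (by linarith)]
      have := le_abs_self (s - t)
      linarith [hx.1.2]

lemma box_smul {ν : Set X → ℂ} (hV : Val ν) (hS : Simple ν) (b : Module.Basis (Fin m) ℝ X)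
    (a : Fin m → ℝ) (ha : ∀ l, 0 ≤ a l) (i : Fin m) (t : ℝ) (ht : 0 ≤ t) :
    ν (Box b (Function.update a i t)) = t * ν (Box b (Function.update a i 1)) := by
  set h : ℝ → ℂ := fun t => ν (Box b (Function.update a i t)) with hh
  have hadd : ∀ s t, 0 ≤ s → 0 ≤ t → h (s + t) = h s + h t := fun s t hs ht =>
    box_add hV hS b a i s t hs ht
  have hbn : ∀ t, 0 ≤ t → (Box b (Function.update a i t)).Nonempty := by
    intro t ht
    refine ⟨0, ?_⟩
    rw [mem_box_update]
    simp only [map_zero]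
    exact ⟨⟨le_rfl, ht⟩, fun l _ => ⟨le_rfl, ha l⟩⟩
  have hcont : Continuous (fun t => h (max t 0)) := by
    rw [Metric.continuous_iff]
    intro s ε hε
    obtain ⟨δ, hδ, hc⟩ := hV.cont _ (cc_box b _) (hbn (max s 0) (le_max_right _ _)) ε hε
    refine ⟨δ / (‖b i‖ + 1), by positivity, fun t htd => ?_⟩
    rw [dist_eq_norm]
    refine hc _ (cc_box b _) (hbn (max t 0) (le_max_right _ _)) ?_
    have h1 : |max s 0 - max t 0| ≤ |s - t| := abs_max_sub_max_le_abs s t 0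
    have h2 : |max s 0 - max t 0| * ‖b i‖ ≤ δ := by
      rw [lt_div_iff₀ (by positivity), dist_comm, Real.dist_eq] at htd
      calc |max s 0 - max t 0| * ‖b i‖ ≤ |s - t| * (‖b i‖ + 1) := by gcongr; linarith
        _ ≤ δ := htd.le
    refine ⟨fun x hx => ?_, fun x hx => ?_⟩
    · obtain ⟨y, hy, hd⟩ := box_near_half b a i _ (max t 0) (le_max_right _ _) x hx
      exact ⟨y, hy, hd.trans h2⟩
    · obtain ⟨y, hy, hd⟩ := box_near_half b a i _ (max s 0) (le_max_right _ _) x hx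
      rw [abs_sub_comm] at hd
      exact ⟨y, hy, by rw [dist_comm]; exact hd.trans h2⟩
  have hH : ∀ p q, 0 ≤ p → 0 ≤ q → h (max (p - q) 0) - h (max (-(p - q)) 0) = h p - h q := by
    intro p q hp hq
    have h0 : h 0 = 0 := by simpa using hadd 0 0 le_rfl le_rfl
    rcases le_total p q with hpq | hpq
    · rw [max_eq_right (by linarith), max_eq_left (by linarith)]
      have := hadd p (q - p) hp (by linarith)
      rw [add_sub_cancel] at this
      rw [neg_sub, h0, this]; ring
    · rw [max_eq_left (by linarith), max_eq_right (by linarith)]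
      have := hadd q (p - q) hq (by linarith)
      rw [add_sub_cancel] at this
      rw [h0, this]; ring
  let H : ℝ →+ ℂ := AddMonoidHom.mk' (fun t => h (max t 0) - h (max (-t) 0)) (by
    intro s t
    have e : s + t = (max s 0 + max t 0) - (max (-s) 0 + max (-t) 0) := by
      have h1 : max s 0 - max (-s) 0 = s := by
        rcases le_total s 0 with h | h
        · rw [max_eq_right h, max_eq_left (by linarith)]; ring
        · rw [max_eq_left h, max_eq_right (by linarith)]; ring
      have h2 : max t 0 - max (-t) 0 = t := by
        rcases le_total t 0 with h | h
        · rw [max_eq_right h, max_eq_left (by linarith)]; ring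
        · rw [max_eq_left h, max_eq_right (by linarith)]; ring
      linarith
    have p1 := le_max_right s 0
    have p2 := le_max_right t 0
    have p3 := le_max_right (-s) 0
    have p4 := le_max_right (-t) 0
    rw [e, hH _ _ (by positivity) (by positivity), hadd _ _ p1 p2, hadd _ _ p3 p4]
    ring)
  have hHc : Continuous H := by
    show Continuous (fun t => h (max t 0) - h (max (-t) 0))
    exact hcont.sub (hcont.comp continuous_neg)
  have h1 := map_real_smul H hHc t 1
  have hHt : ∀ t, 0 ≤ t → H t = h t := by
    intro t ht
    show h (max t 0) - h (max (-t) 0) = h t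
    have := hH t 0 ht le_rfl
    rw [sub_zero] at this
    have h0 : h 0 = 0 := by simpa using hadd 0 0 le_rfl le_rfl
    rw [this, h0, sub_zero]
  rw [smul_eq_mul, mul_one, hHt t ht, hHt 1 zero_le_one] at h1
  simpa using h1
end KlainVal

namespace KlainVal
set_option linter.unusedSectionVars false
variable {X : Type*} [NormedAddCommGroup X] [InnerProductSpace ℝ X] [FiniteDimensional ℝ X]
variable {m : ℕ}

lemma sum_update (w : Fin m → X) (t : Fin m → ℝ) (i : Fin m) (z : X) :
    ∑ l, t l • Function.update w i z l = ∑ l, t l • w l + t i • (z - w i) := by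
  rw [← sub_eq_iff_eq_add', ← Finset.sum_sub_distrib]
  rw [Finset.sum_eq_single i]
  · simp [smul_sub]
  · intro l _ hl; simp [hl]
  · simp

lemma para_smul_pos {ν : Set X → ℂ} (hV : Val ν) (hS : Simple ν) (b : Module.Basis (Fin m) ℝ X)
    (i : Fin m) (d : ℝ) (hd : 0 < d) :
    ν (parallelepiped (Function.update b i (d • b i))) = d * ν (parallelepiped b) := by
  have h := box_smul hV hS b 1 (fun _ => zero_le_one) i d hd.le
  have h1 : Function.update (1 : Fin m → ℝ) i 1 = 1 := Function.update_eq_self i 1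
  rw [h1, ← para_eq_box] at h
  rw [← h]
  congr 1
  ext x
  rw [mem_box_update]
  constructor
  · rintro ⟨t, ht, rfl⟩
    simp only
    rw [sum_update, map_add, coord_sum]
    refine ⟨?_, fun l hl => ?_⟩
    · have : b.coord i (t i • (d • b i - b i)) = t i * (d - 1) := by
        rw [map_smul, map_sub, map_smul, coord_self]; simp
      rw [this]
      have h0 := ht.1 i
      have h1 := ht.2 i
      simp only [Pi.zero_apply, Pi.one_apply] at h0 h1
      constructor <;> nlinarith
    · have : b.coord l (t i • (d • b i - b i)) = 0 := by
        rw [map_smul, map_sub, map_smul, coord_ne b hl]; simp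
      rw [map_add, coord_sum, this, add_zero]
      exact ⟨ht.1 l, ht.2 l⟩
  · rintro ⟨h1, h2⟩
    refine ⟨Function.update (fun l => b.coord l x) i (b.coord i x / d), ⟨fun l => ?_, fun l => ?_⟩, ?_⟩
    · by_cases hl : l = i
      · subst hl; simp only [Function.update_self]; exact div_nonneg h1.1 hd.le
      · rw [Function.update_of_ne hl]; exact (h2 l hl).1
    · by_cases hl : l = i
      · subst hl; simp only [Function.update_self]; exact (div_le_one hd).2 h1.2
      · rw [Function.update_of_ne hl]; exact (h2 l hl).2
    · simp only
      conv_rhs => rw [← sum_coord b x]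
      refine Finset.sum_congr rfl fun l _ => ?_
      by_cases hl : l = i
      · subst hl
        simp only [Function.update_self]
        rw [smul_smul, div_mul_cancel₀ _ hd.ne']
      · rw [Function.update_of_ne hl, Function.update_of_ne hl]

lemma cc_para (w : Fin m → X) : CC (parallelepiped w) := by
  refine ⟨?_, isCompact_Icc.image (by fun_prop)⟩
  have : parallelepiped w = (Fintype.linearCombination ℝ w) '' Icc 0 1 := by
    ext; simp [parallelepiped, Fintype.linearCombination_apply]
  rw [this]
  exact (convex_Icc _ _).linear_image _

lemma para_neg {ν : Set X → ℂ} (hV : Val ν) (w : Fin m → X) (i : Fin m) :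
    ν (parallelepiped (Function.update w i (-w i))) = ν (parallelepiped w) := by
  rw [← hV.trans _ (cc_para w) (-w i)]
  congr 1
  have hmem : ∀ t ∈ Icc (0 : Fin m → ℝ) 1, Function.update t i (1 - t i) ∈ Icc (0 : Fin m → ℝ) 1 := by
    intro t ht
    refine ⟨fun l => ?_, fun l => ?_⟩
    · by_cases hl : l = i
      · subst hl; have := ht.2 l; simp at this ⊢; linarith
      · rw [Function.update_of_ne hl]; exact ht.1 l
    · by_cases hl : l = i
      · subst hl; have := ht.1 l; simp at this ⊢; linarith
      · rw [Function.update_of_ne hl]; exact ht.2 l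
  have hsum : ∀ t : Fin m → ℝ, ∑ l, Function.update t i (1 - t i) l • w l
      = ∑ l, t l • w l + (1 - 2 * t i) • w i := by
    intro t
    rw [← sub_eq_iff_eq_add', ← Finset.sum_sub_distrib, Finset.sum_eq_single i]
    · simp only [Function.update_self]; module
    · intro l _ hl; simp [hl]
    · simp
  ext x
  constructor
  · rintro ⟨t, ht, rfl⟩
    refine ⟨_, ⟨_, hmem t ht, rfl⟩, ?_⟩
    simp only
    rw [hsum, sum_update]
    module
  · rintro ⟨_, ⟨t, ht, rfl⟩, rfl⟩
    refine ⟨_, hmem t ht, ?_⟩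
    simp only
    rw [sum_update, hsum]
    simp only [Function.update_self]
    module

lemma para_smul {ν : Set X → ℂ} (hV : Val ν) (hS : Simple ν) (b : Module.Basis (Fin m) ℝ X)
    (i : Fin m) (d : ℝ) (hd : d ≠ 0) :
    ν (parallelepiped (Function.update b i (d • b i))) = |d| * ν (parallelepiped b) := by
  rcases lt_or_gt_of_ne hd with h | h
  · rw [abs_of_neg h, ← para_smul_pos hV hS b i (-d) (by linarith)]
    have := para_neg hV (Function.update b i (d • b i)) i
    rw [← this]
    simp
  · rw [abs_of_pos h]; exact para_smul_pos hV hS b i d h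

/-- membership in the sheared parallelepiped -/
lemma mem_shear (b : Module.Basis (Fin m) ℝ X) {i j : Fin m} (hij : i ≠ j) (c : ℝ) (x : X) :
    x ∈ parallelepiped (Function.update b j (b j + c • b i)) ↔
      (0 ≤ b.coord i x - c * b.coord j x ∧ b.coord i x - c * b.coord j x ≤ 1) ∧
        ∀ l, l ≠ i → 0 ≤ b.coord l x ∧ b.coord l x ≤ 1 := by
  constructor
  · rintro ⟨t, ht, rfl⟩
    simp only
    rw [sum_update]
    have e : t j • (b j + c • b i - b j) = (t j * c) • b i := by module
    rw [e]
    have hc : ∀ l, l ≠ i → b.coord l (∑ l, t l • b l + (t j * c) • b i) = t l := by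
      intro l hl
      rw [map_add, coord_sum, map_smul, coord_ne b hl]; simp
    rw [hc j hij.symm, map_add, coord_sum, map_smul, coord_self]
    refine ⟨?_, fun l hl => ?_⟩
    · have : t i + (t j * c) • (1:ℝ) - c * t j = t i := by simp; ring
      rw [this]; exact ⟨ht.1 i, ht.2 i⟩
    · rw [hc l hl]; exact ⟨ht.1 l, ht.2 l⟩
  · rintro ⟨h1, h2⟩
    refine ⟨Function.update (fun l => b.coord l x) i (b.coord i x - c * b.coord j x),
      ⟨fun l => ?_, fun l => ?_⟩, ?_⟩
    · by_cases hl : l = i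
      · subst hl; simpa using h1.1
      · rw [Function.update_of_ne hl]; exact (h2 l hl).1
    · by_cases hl : l = i
      · subst hl; simpa using h1.2
      · rw [Function.update_of_ne hl]; exact (h2 l hl).2
    · simp only
      rw [sum_update, Function.update_of_ne hij.symm]
      have : ∑ l, Function.update (fun l => b.coord l x) i (b.coord i x - c * b.coord j x) l • b l
          = ∑ l, b.coord l x • b l + (-(c * b.coord j x)) • b i := by
        rw [← sub_eq_iff_eq_add', ← Finset.sum_sub_distrib, Finset.sum_eq_single i]
        · simp only [Function.update_self]; module
        · intro l _ hl; simp [hl]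
        · simp
      rw [this, sum_coord]
      module

lemma para_shear_pos {ν : Set X → ℂ} (hV : Val ν) (hS : Simple ν) (b : Module.Basis (Fin m) ℝ X)
    {i j : Fin m} (hij : i ≠ j) (c : ℝ) (hc : 0 ≤ c) :
    ν (parallelepiped (Function.update b j (b j + c • b i))) = ν (parallelepiped b) := by
  set f : X →ₗ[ℝ] ℝ := b.coord i - c • b.coord j with hf
  have hfa : ∀ x, f x = b.coord i x - c * b.coord j x := fun x => by simp [hf]
  have hf0 : f ≠ 0 := by
    intro h
    have := hfa (b i)
    rw [h, coord_self, coord_ne b hij.symm] at this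
    simp at this
  set Q := Box b (Function.update 1 i (1 + c)) ∩ {x | f x ≤ 1} with hQ
  have hQc : CC Q := (cc_box b _).le f 1
  have hQm : ∀ x, x ∈ Q ↔ ((0 ≤ b.coord i x ∧ b.coord i x ≤ 1 + c * b.coord j x)) ∧
      ∀ l, l ≠ i → 0 ≤ b.coord l x ∧ b.coord l x ≤ 1 := by
    intro x
    rw [hQ, mem_inter_iff, mem_box_update, mem_ofPred_eq, hfa]
    constructor
    · rintro ⟨⟨h1, h2⟩, h3⟩
      exact ⟨⟨h1.1, by linarith⟩, h2⟩
    · rintro ⟨h1, h2⟩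
      have := (h2 j hij.symm).2
      exact ⟨⟨⟨h1.1, by nlinarith⟩, h2⟩, by linarith⟩
  have e1 := simple_cut hV hS hQc f hf0 0
  have e2 := simple_cut hV hS hQc (b.coord i) (coord_ne_zero b i) 1
  have s1 : Q ∩ {x | 0 ≤ f x} = parallelepiped (Function.update b j (b j + c • b i)) := by
    ext x
    rw [mem_inter_iff, hQm, mem_shear b hij, mem_ofPred_eq, hfa]
    constructor
    · rintro ⟨⟨h1, h2⟩, h3⟩
      exact ⟨⟨h3, by linarith⟩, h2⟩
    · rintro ⟨h1, h2⟩
      have := (h2 j hij.symm).1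
      exact ⟨⟨⟨by nlinarith, by linarith⟩, h2⟩, h1.1⟩
  have s2 : Q ∩ {x | b.coord i x ≤ 1} = parallelepiped b := by
    ext x
    rw [mem_inter_iff, hQm, para_eq_box, ← Function.update_eq_self i (1 : Fin m → ℝ),
      mem_box_update, mem_ofPred_eq]
    constructor
    · rintro ⟨⟨h1, h2⟩, h3⟩
      exact ⟨⟨h1.1, h3⟩, h2⟩
    · rintro ⟨h1, h2⟩
      have := (h2 j hij.symm).1
      have h5 : b.coord i x ≤ 1 := h1.2
      exact ⟨⟨⟨h1.1, by nlinarith⟩, h2⟩, h1.2⟩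
  have s3 : Q ∩ {x | 1 ≤ b.coord i x} = (fun y => b i + y) '' (Q ∩ {x | f x ≤ 0}) := by
    ext x
    rw [mem_inter_iff, hQm, mem_ofPred_eq]
    constructor
    · rintro ⟨⟨h1, h2⟩, h3⟩
      refine ⟨-b i + x, ⟨?_, ?_⟩, by simp⟩
      · rw [hQm, map_add, map_neg, coord_self, map_add, map_neg, coord_ne b hij.symm]
        refine ⟨⟨by linarith, by linarith⟩, fun l hl => ?_⟩
        rw [map_add, map_neg, coord_ne b hl]
        simpa using h2 l hl
      · rw [mem_ofPred_eq, hfa, map_add, map_neg, coord_self, map_add, map_neg, coord_ne b hij.symm]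
        linarith
    · rintro ⟨y, ⟨hy, hy2⟩, rfl⟩
      rw [hQm] at hy
      rw [mem_ofPred_eq, hfa] at hy2
      simp only
      rw [map_add, coord_self, map_add, coord_ne b hij.symm]
      refine ⟨⟨⟨by linarith [hy.1.1], by linarith⟩, fun l hl => ?_⟩, by linarith [hy.1.1]⟩
      rw [map_add, coord_ne b hl]
      simpa using hy.2 l hl
  rw [s1] at e1
  rw [s2, s3, hV.trans _ (hQc.le f 0), e1] at e2
  exact add_left_cancel (e2.trans (add_comm _ _))

/-- right multiplication of a frame by a matrix -/
def wM (w : Fin m → X) (M : Matrix (Fin m) (Fin m) ℝ) (j : Fin m) : X := ∑ i, M i j • w i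

lemma wM_mul (w : Fin m → X) (A B : Matrix (Fin m) (Fin m) ℝ) :
    wM w (A * B) = wM (wM w A) B := by
  ext1 j
  simp only [wM, Matrix.mul_apply, Finset.sum_smul, Finset.smul_sum]
  rw [Finset.sum_comm]
  refine Finset.sum_congr rfl fun i _ => Finset.sum_congr rfl fun l _ => ?_
  rw [smul_smul, mul_comm]

lemma wM_basis (b : Module.Basis (Fin m) ℝ X) (A : Matrix (Fin m) (Fin m) ℝ) (hA : A.det ≠ 0) :
    ∃ b' : Module.Basis (Fin m) ℝ X, (b' : Fin m → X) = wM b A := by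
  have hdet : LinearMap.det (Matrix.toLin b b A) ≠ 0 := by rwa [LinearMap.det_toLin]
  set e := LinearMap.equivOfDetNeZero (Matrix.toLin b b A) hdet
  refine ⟨b.map e, ?_⟩
  ext1 j
  rw [Module.Basis.map_apply]
  show Matrix.toLin b b A (b j) = _
  rw [Matrix.toLin_self]; rfl

lemma wM_transvec (w : Fin m → X) {i j : Fin m} (c : ℝ) :
    wM w (Matrix.transvection i j c) = Function.update w j (w j + c • w i) := by
  ext1 l
  simp only [wM, Matrix.transvection, Matrix.add_apply, add_smul, Finset.sum_add_distrib]
  have h1 : ∑ x, (1 : Matrix (Fin m) (Fin m) ℝ) x l • w x = w l := by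
    simp [Matrix.one_apply, ite_smul]
  have h2 : ∑ x, (Matrix.single i j c) x l • w x = if j = l then c • w i else 0 := by
    by_cases h : j = l
    · simp [Matrix.single_apply, h, ite_smul]
    · simp [Matrix.single_apply, h]
  rw [h1, h2]
  by_cases h : j = l
  · subst h; simp
  · simp [h, Function.update_of_ne (Ne.symm h)]

lemma para_shear {ν : Set X → ℂ} (hV : Val ν) (hS : Simple ν) (b : Module.Basis (Fin m) ℝ X)
    {i j : Fin m} (hij : i ≠ j) (c : ℝ) :
    ν (parallelepiped (wM b (Matrix.transvection i j c))) = ν (parallelepiped b) := by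
  rcases le_total 0 c with h | h
  · rw [wM_transvec]; exact para_shear_pos hV hS b hij c h
  · obtain ⟨b', hb'⟩ := wM_basis b (Matrix.transvection i j c)
      (by rw [Matrix.det_transvection_of_ne _ _ hij]; exact one_ne_zero)
    have h1 := para_shear_pos hV hS b' hij (-c) (by linarith)
    rw [← wM_transvec, hb', ← wM_mul, Matrix.transvection_mul_transvection_same _ _ hij,
      add_neg_cancel, Matrix.transvection_zero] at h1
    rw [← h1]
    congr 2
    ext1 l
    simp [wM, Matrix.one_apply, ite_smul]

lemma para_diag {ν : Set X → ℂ} (hV : Val ν) (hS : Simple ν) (b : Module.Basis (Fin m) ℝ X)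
    (D : Fin m → ℝ) (hD : ∀ i, D i ≠ 0) (s : Finset (Fin m)) :
    ν (parallelepiped (fun j => (if j ∈ s then D j else 1) • b j)) =
      (∏ j ∈ s, |D j| : ℝ) * ν (parallelepiped b) := by
  induction s using Finset.induction_on with
  | empty => simp
  | insert i s hi ih =>
    have hu : ∀ j, IsUnit (if j ∈ s then D j else 1) := by
      intro j
      split_ifs
      · exact (hD j).isUnit
      · exact isUnit_one
    have h := para_smul hV hS (b.isUnitSMul hu) i (D i) (hD i)
    have e1 : (b.isUnitSMul hu : Fin m → X) = fun j => (if j ∈ s then D j else 1) • b j := by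
      ext1 j; rw [Module.Basis.isUnitSMul_apply]
    rw [e1, ih] at h
    rw [Finset.prod_insert hi, Complex.ofReal_mul, mul_assoc, ← h]
    congr 2
    ext1 j
    by_cases hj : j = i
    · subst hj; simp [hi]
    · simp [hj]

theorem para_matrix {ν : Set X → ℂ} (hV : Val ν) (hS : Simple ν)
    (M : Matrix (Fin m) (Fin m) ℝ) (hM : M.det ≠ 0) : ∀ b : Module.Basis (Fin m) ℝ X,
    ν (parallelepiped (wM b M)) = (|M.det| : ℝ) * ν (parallelepiped b) := by
  refine Matrix.diagonal_transvection_induction_of_det_ne_zero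
    (fun M => ∀ b : Module.Basis (Fin m) ℝ X,
      ν (parallelepiped (wM b M)) = (|M.det| : ℝ) * ν (parallelepiped b)) M hM ?_ ?_ ?_
  · intro D hD b
    rw [Matrix.det_diagonal] at hD ⊢
    have hD' : ∀ i, D i ≠ 0 := fun i => (Finset.prod_ne_zero_iff.1 hD) i (Finset.mem_univ i)
    have := para_diag hV hS b D hD' Finset.univ
    rw [Finset.abs_prod, ← this]
    congr 2
    ext1 j
    simp [wM, Matrix.diagonal_apply, ite_smul]
  · intro t b
    rw [Matrix.TransvectionStruct.det, abs_one, Complex.ofReal_one, one_mul]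
    exact para_shear hV hS b t.hij t.c
  · intro A B hA hB ihA ihB b
    obtain ⟨b', hb'⟩ := wM_basis b A hA
    rw [wM_mul, ← hb', ihB b', hb', ihA b, Matrix.det_mul, abs_mul, Complex.ofReal_mul]
    ring

theorem para_law {ν : Set X → ℂ} (hV : Val ν) (hS : Simple ν) (b : Module.Basis (Fin m) ℝ X)
    (u : X →ₗ[ℝ] X) (hu : LinearMap.det u ≠ 0) :
    ν (parallelepiped (fun j => u (b j))) = (|LinearMap.det u| : ℝ) * ν (parallelepiped b) := by
  have hd : (LinearMap.toMatrix b b u).det = LinearMap.det u := LinearMap.det_toMatrix b u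
  rw [← hd, ← para_matrix hV hS _ (by rw [hd]; exact hu) b]
  congr 2
  ext1 j
  simp only [wM, LinearMap.toMatrix_apply]
  exact (b.sum_repr (u (b j))).symm
end KlainVal

namespace KlainVal
set_option linter.unusedSectionVars false

/-- Euclidean space -/
abbrev EE (m : ℕ) := EuclideanSpace ℝ (Fin m)

lemma para_cases {m : ℕ} {ν : Set (EE m) → ℂ} (hS : Simple ν)
    (w : Fin m → EE m) : (∃ b : Module.Basis (Fin m) ℝ (EE m), ⇑b = w) ∨
      (∀ u : EE m →ₗ[ℝ] EE m, LinearMap.det u ≠ 0 → ν (u '' parallelepiped w) = 0) := by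
  by_cases h : Submodule.span ℝ (range w) = ⊤
  · left
    exact ⟨basisOfTopLeSpanOfCardEqFinrank w h.ge (by simp), by simp⟩
  · right
    intro u hu
    obtain ⟨f, hf, hle⟩ := Submodule.exists_le_ker_of_lt_top _ (lt_top_iff_ne_top.2 h)
    set e := LinearMap.equivOfDetNeZero u hu
    have he : ∀ x, e.symm (u x) = x := fun x => e.symm_apply_apply x
    rw [image_parallelepiped]
    refine hS _ (cc_para _) (f ∘ₗ e.symm.toLinearMap) 0 ?_ ?_
    · intro h0
      apply hf
      ext1 x
      have := LinearMap.congr_fun h0 (u x)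
      simpa [he] using this
    · rw [← image_parallelepiped]
      rintro _ ⟨x, hx, rfl⟩
      have hx' : x ∈ Submodule.span ℝ (range w) := by
        rw [mem_parallelepiped_iff] at hx
        obtain ⟨t, ht, rfl⟩ := hx
        exact Submodule.sum_mem _ fun i _ => Submodule.smul_mem _ _ (Submodule.subset_span ⟨i, rfl⟩)
      have := hle hx'
      simpa [he] using this

lemma para_inv {m : ℕ} {ν : Set (EE m) → ℂ} (hV : Val ν) (hS : Simple ν)
    (u : EE m →ₗ[ℝ] EE m) (hu : LinearMap.det u ≠ 0) (w : Fin m → EE m) :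
    ν (u '' parallelepiped w) = (|LinearMap.det u| : ℝ) * ν (parallelepiped w) := by
  rcases para_cases hS w with ⟨b, rfl⟩ | h
  · rw [image_parallelepiped]
    exact para_law hV hS b u hu
  · rw [h u hu]
    have := h LinearMap.id (by simp)
    simp only [LinearMap.id_coe, image_id] at this
    rw [this, mul_zero]

lemma para_hom {m k : ℕ} (hk : k ≠ m) {ν : Set (EE m) → ℂ} (hV : Val ν) (hS : Simple ν)
    (hh : ∀ K, CC K → ν ((fun x => (2:ℝ) • x) '' K) = 2 ^ k * ν K) (w : Fin m → EE m) :
    ν (parallelepiped w) = 0 := by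
  have hd : LinearMap.det ((2:ℝ) • (LinearMap.id : EE m →ₗ[ℝ] EE m)) = 2 ^ m := by
    rw [LinearMap.det_smul]; simp
  have h1 := para_inv hV hS ((2:ℝ) • LinearMap.id) (by rw [hd]; positivity) w
  have h2 := hh _ (cc_para w)
  have h3 : (((2:ℝ) • (LinearMap.id : EE m →ₗ[ℝ] EE m) : EE m →ₗ[ℝ] EE m) : EE m → EE m) =
      fun x => (2:ℝ) • x := rfl
  rw [h3, h2, hd, abs_of_pos (by positivity)] at h1
  push_cast at h1
  by_contra h0
  have h4 := mul_right_cancel₀ h0 h1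
  have h5 : (2:ℕ) ^ k = 2 ^ m := by exact_mod_cast h4
  exact hk (Nat.pow_right_injective le_rfl h5)

lemma Val.sub {m : ℕ} {ν ρ : Set (EE m) → ℂ} (h1 : Val ν) (h2 : Val ρ) :
    Val (fun S => ν S - ρ S) := by
  refine ⟨by simp [h1.empty, h2.empty], ?_, ?_, ?_, ?_⟩
  · intro K hK f c
    linear_combination h1.cut K hK f c - h2.cut K hK f c
  · intro K hK x
    simp only [h1.trans K hK x, h2.trans K hK x]
  · intro K hK
    simp only [h1.even K hK, h2.even K hK]
  · intro K hK hne ε hε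
    obtain ⟨δ1, hδ1, h1⟩ := h1.cont K hK hne (ε/2) (by linarith)
    obtain ⟨δ2, hδ2, h2⟩ := h2.cont K hK hne (ε/2) (by linarith)
    refine ⟨min δ1 δ2, lt_min hδ1 hδ2, fun L hL hLne hn => ?_⟩
    have a := h1 L hL hLne (hn.mono (min_le_left _ _))
    have b := h2 L hL hLne (hn.mono (min_le_right _ _))
    have : ν L - ρ L - (ν K - ρ K) = (ν L - ν K) - (ρ L - ρ K) := by ring
    rw [this]
    linarith [norm_sub_le (ν L - ν K) (ρ L - ρ K)]

section general
variable {V : Type*} [NormedAddCommGroup V] [NormedSpace ℝ V]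

/-- all pullbacks of `F` are valuations -/
def PB (F : Set V → ℂ) : Prop :=
  ∀ (m : ℕ) (φ : EE m →ₗ[ℝ] V), Function.Injective φ → Val (fun S => F (φ '' S))

/-- `F` vanishes in dimension `m` -/
def Vn (F : Set V → ℂ) (m : ℕ) : Prop :=
  ∀ (φ : EE m →ₗ[ℝ] V), Function.Injective φ → ∀ K, CC K → F (φ '' K) = 0

lemma simple_zero (ν : Set (EE 0) → ℂ) : Simple ν := by
  intro K _ f c hf
  exact absurd (Subsingleton.elim f 0) hf

lemma simple_of_lower {F : Set V → ℂ} (hF : PB F) {m : ℕ} (hm : Vn F m)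
    (φ : EE (m+1) →ₗ[ℝ] V) (hφ : Function.Injective φ) : Simple (fun S => F (φ '' S)) := by
  intro K hK f c hf0 hKc
  have hV := hF _ φ hφ
  rcases K.eq_empty_or_nonempty with rfl | ⟨x0, hx0⟩
  · exact hV.empty
  have hdim : Module.finrank ℝ (EE m) = Module.finrank ℝ (LinearMap.ker f) := by
    have := Module.Dual.finrank_ker_add_one_of_ne_zero (f := f) hf0
    simp only [finrank_euclideanSpace, Fintype.card_fin] at this ⊢
    omega
  set e := LinearEquiv.ofFinrankEq _ _ hdim
  set ψ : EE m →ₗ[ℝ] EE (m+1) := (LinearMap.ker f).subtype ∘ₗ e.toLinearMap with hψ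
  have hinj : Function.Injective ψ := by
    intro x y h
    exact e.injective (Subtype.ext h)
  obtain ⟨π, hπ⟩ := LinearMap.exists_leftInverse_of_injective ψ (LinearMap.ker_eq_bot.2 hinj)
  have hπ' : ∀ y, π (ψ y) = y := fun y => LinearMap.congr_fun hπ y
  have hK' : CC ((fun y => -x0 + y) '' K) := hK.translate _
  refine (hV.trans K hK (-x0)).symm.trans ?_
  have key := hm (φ ∘ₗ ψ) (hφ.comp hinj) (π '' ((fun y => -x0 + y) '' K)) (hK'.image π)
  rw [← key]
  congr 1
  rw [LinearMap.coe_comp, image_comp, ← image_comp ψ π]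
  congr 1
  symm
  refine (image_congr (g := id) ?_).trans (image_id _)
  rintro _ ⟨y, hy, rfl⟩
  have hk : -x0 + y ∈ LinearMap.ker f := by
    rw [LinearMap.mem_ker, map_add, map_neg, hKc _ hx0, hKc _ hy]; simp
  obtain ⟨z, hz⟩ := e.surjective ⟨_, hk⟩
  have hz' : ψ z = -x0 + y := congrArg Subtype.val hz
  show ψ (π (-x0 + y)) = -x0 + y
  rw [← hz', hπ']

theorem vanish {F : Set V → ℂ} (hF : PB F) (N : ℕ)
    (hpar : ∀ m < N, ∀ (φ : EE m →ₗ[ℝ] V), Function.Injective φ →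
      Simple (fun S => F (φ '' S)) → ∀ w : Fin m → EE m, F (φ '' parallelepiped w) = 0) :
    ∀ m < N, Vn F m := by
  intro m
  induction m with
  | zero =>
    intro hm φ hφ
    exact klain 0 _ (hF _ φ hφ) (simple_zero _) (hpar 0 hm φ hφ (simple_zero _))
  | succ m ih =>
    intro hm φ hφ
    have hs := simple_of_lower hF (ih (by omega)) φ hφ
    exact klain _ _ (hF _ φ hφ) hs (hpar _ hm φ hφ hs)

/-- homogeneous functionals vanish in dimension below the degree -/
theorem vanish_lt {F : Set V → ℂ} (hF : PB F) (k : ℕ)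
    (hh : ∀ m (φ : EE m →ₗ[ℝ] V), ∀ K, CC K →
      F (φ '' ((fun x => (2:ℝ) • x) '' K)) = 2 ^ k * F (φ '' K)) :
    ∀ m < k, Vn F m :=
  vanish hF k fun m hm φ hφ hs => para_hom hm.ne' (hF m φ hφ) hs (hh m φ)

lemma det_one_of_norm {m : ℕ} (φ : EE m →ₗ[ℝ] V) (hφ : Function.Injective φ)
    (T : EE m →ₗ[ℝ] EE m) (hT : Function.Surjective T) (hn : ∀ y, ‖φ (T y)‖ = ‖φ y‖) :
    |LinearMap.det T| = 1 := by
  set B : Set (EE m) := {y | ‖φ y‖ ≤ 1} with hB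
  have hc : Continuous φ := φ.continuous_of_finiteDimensional
  have himg : T '' B = B := by
    ext y
    constructor
    · rintro ⟨x, hx, rfl⟩
      show ‖φ (T x)‖ ≤ 1
      rw [hn]; exact hx
    · intro hy
      obtain ⟨x, rfl⟩ := hT y
      refine ⟨x, ?_, rfl⟩
      show ‖φ x‖ ≤ 1
      rw [← hn]; exact hy
  obtain ⟨K, hK, hanti⟩ := (LinearMap.injective_iff_antilipschitz φ).1 hφ
  have hbdd : Bornology.IsBounded B := by
    have : B = φ ⁻¹' (closedBall 0 1) := by ext; simp [hB]
    rw [this]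
    exact hanti.isBounded_preimage isBounded_closedBall
  have hfin : volume B ≠ ⊤ := hbdd.measure_lt_top.ne
  have hpos : volume B ≠ 0 := by
    have ho : IsOpen {y : EE m | ‖φ y‖ < 1} := isOpen_lt hc.norm continuous_const
    have h1 := ho.measure_pos volume ⟨0, by simp⟩
    have h2 : volume {y : EE m | ‖φ y‖ < 1} ≤ volume B :=
      measure_mono fun y (hy : ‖φ y‖ < 1) => (show ‖φ y‖ ≤ 1 from hy.le)
    exact (h1.trans_le h2).ne'
  have h := Measure.addHaar_image_linearMap volume T B
  rw [himg] at h
  have h' : ENNReal.ofReal |LinearMap.det T| * volume B = 1 * volume B := by rw [← h, one_mul]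
  have h2 := (ENNReal.mul_left_inj hpos hfin).1 h'
  rwa [ENNReal.ofReal_eq_one] at h2

end general
end KlainVal

namespace KlainVal
set_option linter.unusedSectionVars false

section evs
variable {V : Type*} [NormedAddCommGroup V] [NormedSpace ℝ V]

open Classical in
/-- extension of a functional on convex bodies to all sets -/
def ev (μ : ConvexBody V → ℂ) (S : Set V) : ℂ :=
  if h : (Convex ℝ S ∧ IsCompact S) ∧ S.Nonempty then μ ⟨S, h.1.1, h.1.2, h.2⟩ else 0

lemma ev_mk (μ : ConvexBody V → ℂ) {S : Set V} (h1 : Convex ℝ S) (h2 : IsCompact S)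
    (h3 : S.Nonempty) : ev μ S = μ ⟨S, h1, h2, h3⟩ := by
  rw [ev, dif_pos ⟨⟨h1, h2⟩, h3⟩]

lemma ev_empty (μ : ConvexBody V → ℂ) : ev μ ∅ = 0 := by
  rw [ev, dif_neg (by simp)]

lemma ev_union {μ : ConvexBody V → ℂ} (hval : IsValuationC μ) {K L M N : Set V}
    (hK : Convex ℝ K ∧ IsCompact K) (hL : Convex ℝ L ∧ IsCompact L)
    (hM : Convex ℝ M ∧ IsCompact M) (hN : Convex ℝ N ∧ IsCompact N)
    (hKn : K.Nonempty) (hLn : L.Nonempty) (hNn : N.Nonempty)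
    (h1 : M = K ∪ L) (h2 : N = K ∩ L) : ev μ M + ev μ N = ev μ K + ev μ L := by
  have hMn : M.Nonempty := by rw [h1]; exact hKn.inl
  rw [ev_mk μ hM.1 hM.2 hMn, ev_mk μ hN.1 hN.2 hNn, ev_mk μ hK.1 hK.2 hKn, ev_mk μ hL.1 hL.2 hLn]
  exact hval _ _ _ _ h1 h2

lemma ev_trans {μ : ConvexBody V → ℂ} (ht : IsTranslationInvariantC μ) {K : Set V}
    (hK : Convex ℝ K ∧ IsCompact K) (x : V) : ev μ (x +ᵥ K) = ev μ K := by
  rcases K.eq_empty_or_nonempty with rfl | hn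
  · simp
  · rw [ev_mk μ hK.1 hK.2 hn, ev_mk μ (hK.1.vadd x) (hK.2.vadd x) (hn.vadd_set)]
    exact ht x _ _ rfl

lemma ev_even {μ : ConvexBody V → ℂ} (ht : IsEvenValC μ) {K : Set V}
    (hK : Convex ℝ K ∧ IsCompact K) : ev μ (-K) = ev μ K := by
  rcases K.eq_empty_or_nonempty with rfl | hn
  · simp
  · rw [ev_mk μ hK.1 hK.2 hn, ev_mk μ hK.1.neg hK.2.neg hn.neg]
    exact ht _ _ rfl

lemma ev_hom {k : ℕ} {μ : ConvexBody V → ℂ} (ht : IsHomogeneousValC k μ) {K : Set V}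
    (hK : Convex ℝ K ∧ IsCompact K) : ev μ ((2:ℝ) • K) = 2 ^ k * ev μ K := by
  rcases K.eq_empty_or_nonempty with rfl | hn
  · simp [ev_empty]
  · rw [ev_mk μ hK.1 hK.2 hn, ev_mk μ (hK.1.smul (2:ℝ)) (hK.2.smul (2:ℝ)) (hn.smul_set)]
    simpa using ht 2 (by norm_num) ⟨K, hK.1, hK.2, hn⟩ ⟨_, hK.1.smul (2:ℝ), hK.2.smul (2:ℝ), hn.smul_set⟩ rfl

lemma ccimg {m : ℕ} {S : Set (EE m)} (hS : CC S) (φ : EE m →ₗ[ℝ] V) :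
    Convex ℝ (φ '' S) ∧ IsCompact (φ '' S) :=
  ⟨hS.1.linear_image φ, hS.2.image φ.continuous_of_finiteDimensional⟩

lemma hom_ev {k : ℕ} {μ : ConvexBody V → ℂ} (ht : IsHomogeneousValC k μ)
    (m : ℕ) (φ : EE m →ₗ[ℝ] V) (K : Set (EE m)) (hK : CC K) :
    ev μ (φ '' ((fun x => (2:ℝ) • x) '' K)) = 2 ^ k * ev μ (φ '' K) := by
  rw [← ev_hom ht (ccimg hK φ)]
  congr 1
  ext z
  simp [mem_smul_set]

theorem PB_ev {μ : ConvexBody V → ℂ} (hval : IsValuationC μ) (hcont : Continuous μ)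
    (htrans : IsTranslationInvariantC μ) (heven : IsEvenValC μ) : PB (ev μ) := by
  intro m φ hφ
  refine ⟨by simp [ev_empty], ?_, ?_, ?_, ?_⟩
  · intro K hK f c
    by_cases h1 : (K ∩ {x | f x ≤ c}).Nonempty
    · by_cases h2 : (K ∩ {x | c ≤ f x}).Nonempty
      · have h3 : (K ∩ {x | f x = c}).Nonempty := by
          obtain ⟨a, ha, ha'⟩ := h1
          obtain ⟨b, hb, hb'⟩ := h2
          obtain ⟨x, hx, hx'⟩ := hK.1.isPreconnected.intermediate_value ha hb
            (lin_cont f).continuousOn ⟨ha', hb'⟩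
          exact ⟨x, hx, hx'⟩
        refine ev_union hval (ccimg (hK.le f c) φ) (ccimg (hK.ge f c) φ) (ccimg hK φ)
          (ccimg (hK.eq f c) φ) (h1.image _) (h2.image _) (h3.image _) ?_ ?_
        · rw [← image_union, ← inter_union_distrib_left]
          congr 1
          symm
          apply inter_eq_left.2
          intro x _
          exact le_total (f x) c
        · rw [← image_inter hφ]
          congr 1
          ext x
          constructor
          · rintro ⟨hx, h⟩
            have h : f x = c := h
            exact ⟨⟨hx, h.le⟩, ⟨hx, h.ge⟩⟩
          · rintro ⟨⟨hx, h⟩, ⟨_, h'⟩⟩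
            exact ⟨hx, le_antisymm h h'⟩
      · rw [not_nonempty_iff_eq_empty] at h2
        have hlt : ∀ x ∈ K, f x < c := by
          intro x hx
          by_contra h
          have : x ∈ K ∩ {x | c ≤ f x} := ⟨hx, not_lt.1 h⟩
          rw [h2] at this; exact this
        have e1 : K ∩ {x | f x ≤ c} = K := inter_eq_left.2 fun x hx => (hlt x hx).le
        have e2 : K ∩ {x | f x = c} = ∅ :=
          eq_empty_of_forall_notMem fun x hx => (hlt x hx.1).ne hx.2
        simp only [h2, e1, e2]
    · rw [not_nonempty_iff_eq_empty] at h1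
      have hlt : ∀ x ∈ K, c < f x := by
        intro x hx
        by_contra h
        have : x ∈ K ∩ {x | f x ≤ c} := ⟨hx, not_lt.1 h⟩
        rw [h1] at this; exact this
      have e1 : K ∩ {x | c ≤ f x} = K := inter_eq_left.2 fun x hx => (hlt x hx).le
      have e2 : K ∩ {x | f x = c} = ∅ :=
        eq_empty_of_forall_notMem fun x hx => (hlt x hx.1).ne' hx.2
      simp only [h1, e1, e2, add_comm]
  · intro K hK x
    rw [← ev_trans htrans (ccimg hK φ) (φ x)]
    congr 1
    ext z
    constructor
    · rintro ⟨_, ⟨y, hy, rfl⟩, rfl⟩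
      exact ⟨φ y, ⟨y, hy, rfl⟩, by simp⟩
    · rintro ⟨_, ⟨y, hy, rfl⟩, rfl⟩
      exact ⟨_, ⟨y, hy, rfl⟩, by simp⟩
  · intro K hK
    rw [← ev_even heven (ccimg hK φ)]
    congr 1
    ext z
    constructor
    · rintro ⟨x, hx, rfl⟩
      exact ⟨-x, hx, by simp⟩
    · rintro ⟨x, hx, hz⟩
      exact ⟨-x, by simpa using hx, by rw [map_neg, hz, neg_neg]⟩
  · intro K hK hne ε hε
    have hc := ccimg hK φ
    rw [Metric.continuous_iff] at hcont
    obtain ⟨δ, hδ, h⟩ := hcont ⟨φ '' K, hc.1, hc.2, hne.image _⟩ ε hε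
    set A := LinearMap.toContinuousLinearMap φ
    have hA := norm_nonneg A
    have hA1 : 0 < ‖A‖ + 1 := by linarith
    refine ⟨δ / 2 / (‖A‖ + 1), by positivity, fun L hL hLn hnear => ?_⟩
    have hd : ∀ x y, dist x y ≤ δ / 2 / (‖A‖ + 1) → dist (φ x) (φ y) ≤ δ / 2 := by
      intro x y hxy
      rw [le_div_iff₀ hA1] at hxy
      rw [dist_eq_norm, ← map_sub]
      have h1 : ‖φ (x - y)‖ ≤ ‖A‖ * ‖x - y‖ := A.le_opNorm _
      rw [dist_eq_norm] at hxy
      nlinarith [norm_nonneg (x - y)]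
    have hc' := ccimg hL φ
    rw [ev_mk μ hc.1 hc.2 (hne.image _), ev_mk μ hc'.1 hc'.2 (hLn.image _), ← dist_eq_norm]
    apply h
    rw [← ConvexBody.hausdorffDist_coe]
    refine lt_of_le_of_lt (hausdorffDist_le_of_mem_dist (r := δ / 2) (by linarith) ?_ ?_)
      (by linarith)
    · rintro _ ⟨y, hy, rfl⟩
      obtain ⟨x, hx, hxy⟩ := hnear.2 y hy
      exact ⟨φ x, ⟨x, hx, rfl⟩, by rw [dist_comm]; exact hd _ _ hxy⟩
    · rintro _ ⟨y, hy, rfl⟩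
      obtain ⟨x, hx, hxy⟩ := hnear.1 y hy
      exact ⟨φ x, ⟨x, hx, rfl⟩, by rw [dist_comm] at hxy; rw [dist_comm, dist_comm] ; exact hd _ _ (by rw [dist_comm]; exact hxy)⟩

end evs
end KlainVal

namespace KlainVal
set_option linter.unusedSectionVars false

variable {n : ℕ}

lemma uAct_apply (g : Matrix (Fin n) (Fin n) ℂ) (x : Cn n) :
    uAct g x = WithLp.toLp 2 (g.mulVec x.ofLp) := Matrix.toLpLin_apply _ _ _ _

lemma uAct_mul (g h : Matrix (Fin n) (Fin n) ℂ) (x : Cn n) :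
    uAct (g * h) x = uAct g (uAct h x) := by
  simp [uAct_apply, Matrix.mulVec_mulVec]

lemma uAct_one (x : Cn n) : uAct (1 : Matrix (Fin n) (Fin n) ℂ) x = x := by
  simp [uAct_apply]

lemma uAct_star_mul {g : Matrix (Fin n) (Fin n) ℂ} (hg : g ∈ Matrix.unitaryGroup (Fin n) ℂ)
    (x : Cn n) : uAct (star g) (uAct g x) = x := by
  rw [← uAct_mul, Matrix.UnitaryGroup.star_mul_self ⟨g, hg⟩, uAct_one]

lemma uAct_inj {g : Matrix (Fin n) (Fin n) ℂ} (hg : g ∈ Matrix.unitaryGroup (Fin n) ℂ) :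
    Function.Injective (uAct g) := fun x y h => by
  rw [← uAct_star_mul hg x, h, uAct_star_mul hg]

lemma uAct_norm {g : Matrix (Fin n) (Fin n) ℂ} (hg : g ∈ Matrix.unitaryGroup (Fin n) ℂ)
    (x : Cn n) : ‖uAct g x‖ = ‖x‖ := by
  have h : inner ℂ (uAct g x) (uAct g x) = inner ℂ x x := by
    have h1 : (g.mulVec x.ofLp) ⬝ᵥ star (g.mulVec x.ofLp) = x.ofLp ⬝ᵥ star x.ofLp := by
      rw [Matrix.star_mulVec, dotProduct_comm, ← Matrix.dotProduct_mulVec, Matrix.mulVec_mulVec,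
        ← Matrix.star_eq_conjTranspose, Matrix.UnitaryGroup.star_mul_self ⟨g, hg⟩,
        Matrix.one_mulVec, dotProduct_comm]
    rw [EuclideanSpace.inner_eq_star_dotProduct, EuclideanSpace.inner_eq_star_dotProduct, uAct_apply]
    exact h1
  rw [inner_self_eq_norm_sq_to_K, inner_self_eq_norm_sq_to_K] at h
  have h2 : ‖uAct g x‖ ^ 2 = ‖x‖ ^ 2 := by exact_mod_cast h
  exact (pow_left_inj₀ (norm_nonneg _) (norm_nonneg _) two_ne_zero).1 h2

/-- complex reflections -/
lemma exists_refl (w : Cn n) (hw : ‖w‖ = 1) (c : ℂ) (hc : c * star c = 1) :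
    ∃ u ∈ Matrix.unitaryGroup (Fin n) ℂ, u.det = c ∧
      ∀ x : Cn n, uAct u x = x + ((c - 1) * inner ℂ w x) • w := by
  have hww : star w.ofLp ⬝ᵥ w.ofLp = 1 := by
    have h := inner_self_eq_norm_sq_to_K (𝕜 := ℂ) w
    rw [EuclideanSpace.inner_eq_star_dotProduct, hw] at h
    rw [dotProduct_comm, h]; simp
  set P : Matrix (Fin n) (Fin n) ℂ := Matrix.vecMulVec w.ofLp (star w.ofLp) with hP
  have hPP : P * P = P := by
    rw [hP, Matrix.vecMulVec_mul_vecMulVec, hww, one_smul]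
  have hPs : star P = P := by
    rw [hP, Matrix.star_eq_conjTranspose, Matrix.conjTranspose_vecMulVec, star_star]
  refine ⟨1 + (c - 1) • P, ?_, ?_, ?_⟩
  · rw [Matrix.mem_unitaryGroup_iff, star_add, star_one, star_smul, hPs]
    have e : (1 + (c - 1) • P) * (1 + star (c - 1) • P)
        = 1 + (star (c - 1) + (c - 1) + (c - 1) * star (c - 1)) • P := by
      rw [add_mul, mul_add, mul_add, one_mul, one_mul, mul_one, smul_mul_smul_comm, hPP]
      module
    rw [e]
    have : star (c - 1) + (c - 1) + (c - 1) * star (c - 1) = 0 := by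
      rw [star_sub, star_one]; linear_combination hc
    rw [this, zero_smul, add_zero]
  · have := Matrix.det_one_add_replicateCol_mul_replicateRow (ι := Unit) ((c - 1) • w.ofLp) (star w.ofLp)
    rw [dotProduct_smul, hww, ← Matrix.vecMulVec_eq, Matrix.smul_vecMulVec] at this
    rw [this]; simp
  · intro x
    rw [uAct_apply, Matrix.add_mulVec, Matrix.one_mulVec, Matrix.smul_mulVec, hP,
      Matrix.vecMulVec_mulVec, EuclideanSpace.inner_eq_star_dotProduct, dotProduct_comm]
    ext i
    simp only [PiLp.add_apply, PiLp.smul_apply, Pi.add_apply, Pi.smul_apply, smul_eq_mul,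
      MulOpposite.smul_eq_mul_unop, MulOpposite.unop_op]
    ring

variable {k : ℕ}

lemma exists_perp (φ : EE k →ₗ[ℝ] Cn n) (h : k < n) :
    ∃ w : Cn n, ‖w‖ = 1 ∧ ∀ y, inner ℂ w (φ y) = 0 := by
  set S : Submodule ℂ (Cn n) := Submodule.span ℂ (range fun i => φ (EuclideanSpace.basisFun (Fin k) ℝ i))
  have hS : Module.finrank ℂ S ≤ k := by
    have := finrank_range_le_card (R := ℂ) (fun i => φ (EuclideanSpace.basisFun (Fin k) ℝ i))
    simpa [Set.finrank] using this
  have hle : ∀ y, φ y ∈ S := by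
    intro y
    rw [← (EuclideanSpace.basisFun (Fin k) ℝ).sum_repr y, map_sum]
    refine Submodule.sum_mem _ fun i _ => ?_
    rw [map_smul, ← Complex.coe_smul]
    exact Submodule.smul_mem _ _ (Submodule.subset_span ⟨i, rfl⟩)
  have hne : Sᗮ ≠ ⊥ := by
    intro hb
    rw [Submodule.orthogonal_eq_bot_iff] at hb
    rw [hb, finrank_top, finrank_euclideanSpace, Fintype.card_fin] at hS
    omega
  obtain ⟨v, hv, hv0⟩ := Submodule.exists_mem_ne_zero_of_ne_bot hne
  refine ⟨((‖v‖⁻¹ : ℝ) : ℂ) • v, ?_, fun y => ?_⟩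
  · rw [norm_smul]
    have := norm_ne_zero_iff.2 hv0
    simp [this]
  · rw [inner_smul_left, Submodule.inner_left_of_mem_orthogonal (hle y) hv, mul_zero]

lemma exists_cplx (φ : EE k →ₗ[ℝ] Cn n) (hφ : Function.Injective φ) (h : n < k) :
    ∃ w : Cn n, ‖w‖ = 1 ∧ ∀ c : ℂ, c • w ∈ LinearMap.range φ := by
  set J : Cn n →ₗ[ℝ] Cn n := (Complex.I • (LinearMap.id : Cn n →ₗ[ℂ] Cn n)).restrictScalars ℝ
  have hJ : ∀ x, J x = Complex.I • x := fun x => rfl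
  have hJi : Function.Injective J := by
    intro x y hxy
    rw [hJ, hJ] at hxy
    exact smul_right_injective _ Complex.I_ne_zero hxy
  have h1 : Module.finrank ℝ (LinearMap.range φ) = k := by
    rw [LinearMap.finrank_range_of_inj hφ]; simp
  have h2 : Module.finrank ℝ (LinearMap.range (J ∘ₗ φ)) = k := by
    have hc : Function.Injective (J ∘ₗ φ) := by
      rw [LinearMap.coe_comp]; exact Function.Injective.comp hJi hφ
    rw [LinearMap.finrank_range_of_inj hc]; simp
  have h3 : Module.finrank ℝ (Cn n) = 2 * n := by
    rw [finrank_real_of_complex]; simp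
  have hnd : ¬ Disjoint (LinearMap.range φ) (LinearMap.range (J ∘ₗ φ)) := by
    intro hd
    have := Submodule.finrank_add_finrank_le_of_disjoint hd
    rw [h1, h2, h3] at this
    omega
  rw [disjoint_iff] at hnd
  obtain ⟨v, ⟨hv1, hv2⟩, hv0⟩ := Submodule.exists_mem_ne_zero_of_ne_bot hnd
  obtain ⟨y, hy⟩ := hv2
  have hy' : φ y = -(Complex.I • v) := by
    rw [← hy]
    show _ = -(Complex.I • (Complex.I • φ y))
    rw [smul_smul, Complex.I_mul_I]; simp
  have hv3 : Complex.I • v ∈ LinearMap.range φ := ⟨-y, by rw [map_neg, hy', neg_neg]⟩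
  have hall : ∀ c : ℂ, c • v ∈ LinearMap.range φ := by
    intro c
    have : c • v = c.re • v + c.im • (Complex.I • v) := by
      conv_lhs => rw [← Complex.re_add_im c]
      rw [add_smul, mul_smul, Complex.coe_smul, Complex.coe_smul]
    rw [this]
    exact Submodule.add_mem _ (Submodule.smul_mem _ _ hv1) (Submodule.smul_mem _ _ hv3)
  refine ⟨((‖v‖⁻¹ : ℝ) : ℂ) • v, ?_, fun c => ?_⟩
  · rw [norm_smul]
    have := norm_ne_zero_iff.2 hv0
    simp [this]
  · rw [smul_smul]; exact hall _

end KlainVal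

namespace KlainVal
set_option linter.unusedSectionVars false

variable {n k : ℕ}

/-- real-linear version of the action -/
def rAct (g : Matrix (Fin n) (Fin n) ℂ) : Cn n →ₗ[ℝ] Cn n := (uAct g).restrictScalars ℝ

lemma ev_su {μ : ConvexBody (Cn n) → ℂ} (hsu : IsSpecialUnitaryInvariant μ)
    {g : Matrix (Fin n) (Fin n) ℂ} (hg : g ∈ Matrix.specialUnitaryGroup (Fin n) ℂ)
    {S : Set (Cn n)} (hS : Convex ℝ S ∧ IsCompact S) : ev μ (rAct g '' S) = ev μ S := by
  rcases S.eq_empty_or_nonempty with rfl | hn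
  · simp
  · have h2 : IsCompact (rAct g '' S) := hS.2.image (rAct g).continuous_of_finiteDimensional
    rw [ev_mk μ hS.1 hS.2 hn, ev_mk μ (hS.1.linear_image (rAct g)) h2 (hn.image _)]
    exact hsu g hg _ _ rfl

lemma split_su {g u : Matrix (Fin n) (Fin n) ℂ} (hg : g ∈ Matrix.unitaryGroup (Fin n) ℂ)
    (hu : u ∈ Matrix.unitaryGroup (Fin n) ℂ) (hd : u.det = g.det) :
    g * star u ∈ Matrix.specialUnitaryGroup (Fin n) ℂ ∧
      ∀ S : Set (Cn n), rAct g '' S = rAct (g * star u) '' (rAct u '' S) := by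
  refine ⟨?_, ?_⟩
  · rw [Matrix.mem_specialUnitaryGroup_iff]
    refine ⟨mul_mem hg (Unitary.star_mem hu), ?_⟩
    have h1 := congrArg Matrix.det (Matrix.mem_unitaryGroup_iff.1 hu)
    rw [Matrix.det_mul, Matrix.det_one] at h1
    rw [Matrix.det_mul, ← hd, h1]
  · intro S
    rw [image_image]
    refine image_congr fun x _ => ?_
    show uAct g x = uAct (g * star u) (uAct u x)
    rw [uAct_mul, uAct_star_mul hu]

lemma exists_pull (φ : EE k →ₗ[ℝ] Cn n) (hφ : Function.Injective φ)
    {u : Matrix (Fin n) (Fin n) ℂ} (hu : u ∈ Matrix.unitaryGroup (Fin n) ℂ)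
    (hr : ∀ y, rAct u (φ y) ∈ LinearMap.range φ) :
    ∃ T : EE k →ₗ[ℝ] EE k, |LinearMap.det T| = 1 ∧ ∀ y, φ (T y) = rAct u (φ y) := by
  obtain ⟨π, hπ⟩ := LinearMap.exists_leftInverse_of_injective φ (LinearMap.ker_eq_bot.2 hφ)
  have hπ' : ∀ y, π (φ y) = y := fun y => LinearMap.congr_fun hπ y
  have hT : ∀ y, φ ((π ∘ₗ rAct u ∘ₗ φ) y) = rAct u (φ y) := by
    intro y
    obtain ⟨z, hz⟩ := hr y
    show φ (π (rAct u (φ y))) = _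
    rw [← hz, hπ']
  refine ⟨π ∘ₗ rAct u ∘ₗ φ, ?_, hT⟩
  refine det_one_of_norm φ hφ _ ?_ ?_
  · apply LinearMap.surjective_of_injective
    intro x y hxy
    have := congrArg φ hxy
    rw [hT, hT] at this
    exact hφ (uAct_inj hu this)
  · intro y
    rw [hT]
    exact uAct_norm hu _

theorem main (hkn : k ≠ n)
    (μ : ConvexBody (Cn n) → ℂ) (hval : IsValuationC μ) (hcont : Continuous μ)
    (htrans : IsTranslationInvariantC μ) (heven : IsEvenValC μ)
    (hhom : IsHomogeneousValC k μ) (hsu : IsSpecialUnitaryInvariant μ) :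
    IsUnitaryInvariant μ := by
  intro g hg K L hL
  have hPB : PB (ev μ) := PB_ev hval hcont htrans heven
  set F : Set (Cn n) → ℂ := fun S => ev μ (rAct g '' S) - ev μ S with hF
  have hgi : Function.Injective (rAct g) := uAct_inj hg
  have hFP : PB F := by
    intro m φ hφ
    have h1 := hPB m (rAct g ∘ₗ φ) (by rw [LinearMap.coe_comp]; exact hgi.comp hφ)
    have h2 := h1.sub (hPB m φ hφ)
    simp only [LinearMap.coe_comp, image_comp] at h2
    exact h2
  have hlow := vanish_lt hPB k (hom_ev hhom)
  have hdetg : g.det * star g.det = 1 := by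
    have h1 := congrArg Matrix.det (Matrix.mem_unitaryGroup_iff.1 hg)
    rwa [Matrix.det_mul, Matrix.det_one, Matrix.star_eq_conjTranspose, Matrix.det_conjTranspose] at h1
  have hvan := vanish hFP (2 * n + 1) (by
    intro m _ φ hφ hs w
    by_cases hmk : k = m
    · subst hmk
      have hcc := ccimg (cc_para w) φ
      rcases lt_or_gt_of_ne hkn with h | h
      · obtain ⟨v, hv, hperp⟩ := exists_perp φ h
        obtain ⟨u, hu, hud, hux⟩ := exists_refl v hv g.det hdetg
        obtain ⟨h1, h2⟩ := split_su hg hu hud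
        have h3 : rAct u '' (φ '' parallelepiped w) = φ '' parallelepiped w := by
          refine (image_congr (g := id) ?_).trans (image_id _)
          rintro _ ⟨y, hy, rfl⟩
          show uAct u (φ y) = φ y
          rw [hux, hperp, mul_zero, zero_smul, add_zero]
        show ev μ (rAct g '' _) - ev μ _ = 0
        rw [h2, h3, ev_su hsu h1 hcc, sub_self]
      · obtain ⟨v, hv, hcx⟩ := exists_cplx φ hφ h
        obtain ⟨u, hu, hud, hux⟩ := exists_refl v hv g.det hdetg
        obtain ⟨h1, h2⟩ := split_su hg hu hud
        obtain ⟨T, hT, hTφ⟩ := exists_pull φ hφ hu (fun y => by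
          show uAct u (φ y) ∈ _
          rw [hux]
          exact Submodule.add_mem _ ⟨y, rfl⟩ (hcx _))
        have hsim : Simple (fun S => ev μ (φ '' S)) := by
          obtain ⟨j, rfl⟩ : ∃ j, k = j + 1 := ⟨k - 1, by omega⟩
          exact simple_of_lower hPB (hlow j (by omega)) φ hφ
        have hT0 : LinearMap.det T ≠ 0 := by
          intro h0; rw [h0] at hT; simp at hT
        have h3 := para_inv (hPB k φ hφ) hsim T hT0 w
        rw [hT, Complex.ofReal_one, one_mul] at h3
        have h4 : rAct u '' (φ '' parallelepiped w) = φ '' (T '' parallelepiped w) := by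
          rw [image_image, image_image]
          exact image_congr fun y _ => (hTφ y).symm
        show ev μ (rAct g '' _) - ev μ _ = 0
        rw [h2, h4, ev_su hsu h1 (ccimg (by rw [image_parallelepiped]; exact cc_para _) φ), h3,
          sub_self]
    · refine para_hom hmk (hFP m φ hφ) hs (fun K hK => ?_) w
      have a := hom_ev hhom m (rAct g ∘ₗ φ) K hK
      have b := hom_ev hhom m φ K hK
      rw [LinearMap.coe_comp, image_comp, image_comp] at a
      show ev μ (rAct g '' _) - ev μ _ = _ * (ev μ (rAct g '' _) - ev μ _)
      rw [a, b, mul_sub]) (2 * n) (by omega)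
  have hdim : Module.finrank ℝ (EE (2 * n)) = Module.finrank ℝ (Cn n) := by
    rw [finrank_real_of_complex]; simp
  set e := LinearEquiv.ofFinrankEq _ _ hdim
  have key := hvan e.toLinearMap e.injective (e.symm '' (K : Set (Cn n)))
    ⟨K.convex.linear_image e.symm.toLinearMap,
      K.isCompact.image e.symm.toLinearMap.continuous_of_finiteDimensional⟩
  have hK : (e.toLinearMap : EE (2*n) → Cn n) '' (e.symm '' (K : Set (Cn n))) = K := by
    rw [image_image]; simp
  rw [hK] at key
  have hLe : ev μ (L : Set (Cn n)) = μ L := ev_mk μ L.convex L.isCompact L.nonempty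
  have hKe : ev μ (K : Set (Cn n)) = μ K := ev_mk μ K.convex K.isCompact K.nonempty
  rw [← hLe, ← hKe, hL]
  exact sub_eq_zero.1 key

end KlainVal

/-- for `k ≠ n`, every continuous, translation invariant, even,
`k`-homogeneous, `SU(n)`-invariant valuation on `ℂⁿ` is `U(n)`-invariant. -/
theorem statement18 (n k : ℕ) (hn : 1 ≤ n) (hk : k ≤ 2 * n) (hkn : k ≠ n)
    (μ : ConvexBody (Cn n) → ℂ) (hval : IsValuationC μ) (hcont : Continuous μ)
    (htrans : IsTranslationInvariantC μ) (heven : IsEvenValC μ)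
    (hhom : IsHomogeneousValC k μ) (hsu : IsSpecialUnitaryInvariant μ) :
    IsUnitaryInvariant μ := by
  exact KlainVal.main hkn μ hval hcont htrans heven hhom hsu

end
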